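/- Let K be a field of characteristic zero, R = K[x_1, ..., x_n] and S = K[e_1, ..., e_n] ⊆ R its subring of symmetric polynomials. Let f_2, f_3, ..., f_n, f_d ∈ S be homogeneous elements with deg f_i = i for i = 2, 3, ..., n and deg f_d = d, forming a regular sequence in S, where d > n and d is a prime number. Then both B = S/(f_2, f_3, ..., f_n, f_d)S and A = R/(f_2, f_3, ..., f_n, f_d)R have the SLP. -/

import Mathlib

set_option maxHeartbeats 1000000
set_option synthInstance.maxHeartbeats 400000

open TensorProduct

section LefschetzPrelude

variable (K : Type) [Field K]

/-- `𝒜` makes `A` into a graded Artinian `K`-algebra (with possibly non-standard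
grading): `A` is the internal direct sum of the `𝒜 i`, the grading is
multiplicative, `A₀ = K·1` and `A` is finite dimensional over `K`. -/
def IsGradedArtinAlg {A : Type} [CommRing A] [Algebra K A]
    (𝒜 : ℕ → Submodule K A) : Prop :=
  DirectSum.IsInternal 𝒜 ∧
  (1 : A) ∈ 𝒜 0 ∧
  (∀ i j : ℕ, ∀ x ∈ 𝒜 i, ∀ y ∈ 𝒜 j, x * y ∈ 𝒜 (i + j)) ∧
  𝒜 0 = Submodule.span K {(1 : A)} ∧
  FiniteDimensional K A

/-- `c` is the top degree of the grading `𝒜`. -/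
def GradedTop {A : Type} [CommRing A] [Algebra K A]
    (𝒜 : ℕ → Submodule K A) (c : ℕ) : Prop :=
  𝒜 c ≠ ⊥ ∧ ∀ i : ℕ, c < i → 𝒜 i = ⊥

/-- `ℳ` makes the `A`-module `V` into a finite graded module over the graded
algebra `(A, 𝒜)`. -/
def IsGradedMod {A V : Type} [CommRing A] [Algebra K A] [AddCommGroup V]
    [Module K V] [Module A V] [IsScalarTower K A V]
    (𝒜 : ℕ → Submodule K A) (ℳ : ℤ → Submodule K V) : Prop :=
  DirectSum.IsInternal ℳ ∧
  (∀ (i : ℕ) (j : ℤ), ∀ a ∈ 𝒜 i, ∀ v ∈ ℳ j, a • v ∈ ℳ (j + i)) ∧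
  FiniteDimensional K V

/-- The graded pieces of `ℳ` are supported exactly between degrees `a` and `b`. -/
def GradedBetween {V : Type} [AddCommGroup V] [Module K V]
    (ℳ : ℤ → Submodule K V) (a b : ℤ) : Prop :=
  a ≤ b ∧ ℳ a ≠ ⊥ ∧ ℳ b ≠ ⊥ ∧ ∀ i : ℤ, i < a ∨ b < i → ℳ i = ⊥

/-- Multiplication by `g : A` on the `A`-module `V`, as a `K`-linear endomorphism. -/
noncomputable def mulMap {A : Type} (V : Type) [CommRing A] [Algebra K A] [AddCommGroup V]
    [Module K V] [Module A V] [IsScalarTower K A V] (g : A) : Module.End K V :=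
  (LinearMap.lsmul A V g).restrictScalars K

/-- The endomorphism `f` of the graded vector space `ℳ` (supported between
degrees `a` and `b`) is a weak Lefschetz operator: each `f : ℳ i → ℳ (i+1)` is
injective or surjective. -/
def IsWLEndo {V : Type} [AddCommGroup V] [Module K V]
    (ℳ : ℤ → Submodule K V) (a b : ℤ) (f : Module.End K V) : Prop :=
  ∀ i : ℤ, a ≤ i → i + 1 ≤ b →
    ((∀ v ∈ ℳ i, f v = 0 → v = 0) ∨ (∀ w ∈ ℳ (i + 1), ∃ v ∈ ℳ i, f v = w))

/-- The endomorphism `f` of the graded vector space `ℳ` (supported between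
degrees `a` and `b`) is a strong Lefschetz operator:
`f^(b-a-2i) : ℳ (a+i) → ℳ (b-i)` is bijective for all `0 ≤ 2i ≤ b-a`. -/
def IsSLEndo {V : Type} [AddCommGroup V] [Module K V]
    (ℳ : ℤ → Submodule K V) (a b : ℤ) (f : Module.End K V) : Prop :=
  ∀ i : ℕ, 2 * (i : ℤ) ≤ b - a →
    (∀ v ∈ ℳ (a + i), (f ^ (b - a - 2 * i).toNat) v = 0 → v = 0) ∧
    (∀ w ∈ ℳ (b - i), ∃ v ∈ ℳ (a + i), (f ^ (b - a - 2 * i).toNat) v = w)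

/-- `g ∈ A₁` is a weak Lefschetz element for the graded module `(V, ℳ)`. -/
def IsWLElem {A V : Type} [CommRing A] [Algebra K A] [AddCommGroup V]
    [Module K V] [Module A V] [IsScalarTower K A V]
    (𝒜 : ℕ → Submodule K A) (ℳ : ℤ → Submodule K V) (a b : ℤ) (g : A) : Prop :=
  g ∈ 𝒜 1 ∧ IsWLEndo K ℳ a b (mulMap K V g)

/-- `g ∈ A₁` is a strong Lefschetz element for the graded module `(V, ℳ)`. -/
def IsSLElem {A V : Type} [CommRing A] [Algebra K A] [AddCommGroup V]
    [Module K V] [Module A V] [IsScalarTower K A V]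
    (𝒜 : ℕ → Submodule K A) (ℳ : ℤ → Submodule K V) (a b : ℤ) (g : A) : Prop :=
  g ∈ 𝒜 1 ∧ IsSLEndo K ℳ a b (mulMap K V g)

/-- The Hilbert function of the graded vector space `ℳ`. -/
noncomputable def hilb {V : Type} [AddCommGroup V] [Module K V]
    (ℳ : ℤ → Submodule K V) (i : ℤ) : ℕ :=
  Module.finrank K (ℳ i)

/-- The Hilbert function of `ℳ`, supported between `a` and `b`, is symmetric. -/
def SymHilb {V : Type} [AddCommGroup V] [Module K V]
    (ℳ : ℤ → Submodule K V) (a b : ℤ) : Prop :=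
  ∀ i : ℤ, hilb K ℳ (a + i) = hilb K ℳ (b - i)

/-- The Hilbert function of `ℳ`, supported between `a` and `b`, is unimodal. -/
def UnimodalHilb {V : Type} [AddCommGroup V] [Module K V]
    (ℳ : ℤ → Submodule K V) (a b : ℤ) : Prop :=
  ∃ m : ℤ, a ≤ m ∧ m ≤ b ∧
    (∀ i j : ℤ, a ≤ i → i ≤ j → j ≤ m → hilb K ℳ i ≤ hilb K ℳ j) ∧
    (∀ i j : ℤ, m ≤ i → i ≤ j → j ≤ b → hilb K ℳ j ≤ hilb K ℳ i)

/-- The Sperner number of `ℳ` (supported between `a` and `b`). -/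
noncomputable def sperner {V : Type} [AddCommGroup V] [Module K V]
    (ℳ : ℤ → Submodule K V) (a b : ℤ) : ℕ :=
  (Finset.Icc a b).sup fun i => hilb K ℳ i

/-- The CoSperner number of `ℳ` (supported between `a` and `b`). -/
noncomputable def coSperner {V : Type} [AddCommGroup V] [Module K V]
    (ℳ : ℤ → Submodule K V) (a b : ℤ) : ℕ :=
  ∑ i ∈ Finset.Icc a (b - 1), min (hilb K ℳ i) (hilb K ℳ (i + 1))

/-- `SP_k(V) = Σ_{i=a}^{b} max (dim V_i - dim V_{i-k}) 0` (via truncated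
subtraction on `ℕ`). -/
noncomputable def spernerVec {V : Type} [AddCommGroup V] [Module K V]
    (ℳ : ℤ → Submodule K V) (a b : ℤ) (k : ℕ) : ℕ :=
  ∑ i ∈ Finset.Icc a b, (hilb K ℳ i - hilb K ℳ (i - (k : ℤ)))

/-- `d` is the multiset of Jordan block sizes of the (nilpotent) endomorphism `f`:
all entries are positive and `dim ker f^k = Σ_{n ∈ d} min n k` for every `k`. -/
def IsJordanType {V : Type} [AddCommGroup V] [Module K V]
    (f : Module.End K V) (d : Multiset ℕ) : Prop :=
  (∀ n ∈ d, 0 < n) ∧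
  ∀ k : ℕ, Module.finrank K (LinearMap.ker (f ^ k)) = (d.map fun n => min n k).sum

/-- `g ∈ A₁` is a weak Lefschetz element of the graded algebra `(A, 𝒜)` with top
degree `c`. -/
def IsAlgWLElem {A : Type} [CommRing A] [Algebra K A]
    (𝒜 : ℕ → Submodule K A) (c : ℕ) (g : A) : Prop :=
  g ∈ 𝒜 1 ∧ ∀ i : ℕ, i + 1 ≤ c →
    ((∀ v ∈ 𝒜 i, g * v = 0 → v = 0) ∨ (∀ w ∈ 𝒜 (i + 1), ∃ v ∈ 𝒜 i, g * v = w))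

/-- `g ∈ A₁` is a strong Lefschetz element of the graded algebra `(A, 𝒜)` with top
degree `c`: `×g^(c-2i) : A_i → A_{c-i}` is bijective for `0 ≤ 2i ≤ c`. -/
def IsAlgSLElem {A : Type} [CommRing A] [Algebra K A]
    (𝒜 : ℕ → Submodule K A) (c : ℕ) (g : A) : Prop :=
  g ∈ 𝒜 1 ∧ ∀ i : ℕ, 2 * i ≤ c →
    (∀ v ∈ 𝒜 i, g ^ (c - 2 * i) * v = 0 → v = 0) ∧
    (∀ w ∈ 𝒜 (c - i), ∃ v ∈ 𝒜 i, g ^ (c - 2 * i) * v = w)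

/-- The graded algebra `(A, 𝒜)` has the weak Lefschetz property. -/
def AlgHasWLP {A : Type} [CommRing A] [Algebra K A] (𝒜 : ℕ → Submodule K A) : Prop :=
  ∃ c : ℕ, GradedTop K 𝒜 c ∧ ∃ g : A, IsAlgWLElem K 𝒜 c g

/-- The graded algebra `(A, 𝒜)` has the strong Lefschetz property. -/
def AlgHasSLP {A : Type} [CommRing A] [Algebra K A] (𝒜 : ℕ → Submodule K A) : Prop :=
  ∃ c : ℕ, GradedTop K 𝒜 c ∧ ∃ g : A, IsAlgSLElem K 𝒜 c g

/-- The graded pieces of the tensor product `V ⊗[K] W` of two graded vector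
spaces: `(ℳ ⊗ 𝒩)_k = Σ_{i+j=k} ℳ_i ⊗ 𝒩_j`. -/
noncomputable def tensorGrading {V W : Type} [AddCommGroup V] [Module K V]
    [AddCommGroup W] [Module K W] (ℳ : ℤ → Submodule K V) (𝒩 : ℤ → Submodule K W)
    (k : ℤ) : Submodule K (V ⊗[K] W) :=
  ⨆ i : ℤ, LinearMap.range (TensorProduct.map (ℳ i).subtype (𝒩 (k - i)).subtype)

/-- Reindex a `ℕ`-indexed grading by `ℤ`. -/
noncomputable def natToZ {V : Type} [AddCommGroup V] [Module K V]
    (ℒ : ℕ → Submodule K V) (i : ℤ) : Submodule K V :=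
  if 0 ≤ i then ℒ i.toNat else ⊥

/-- The truncated polynomial ring `K[t]/(t^α)`. -/
abbrev TruncPoly (α : ℕ) : Type :=
  Polynomial K ⧸ Ideal.span {(Polynomial.X : Polynomial K) ^ α}

/-- The image of `t` in `K[t]/(t^α)`. -/
noncomputable def tbar (α : ℕ) : TruncPoly K α :=
  Ideal.Quotient.mk _ Polynomial.X

/-- The standard grading of `K[t]/(t^α)` (with `deg t = 1`): the degree-`j` piece
is spanned by the class of `t^j` for `0 ≤ j < α`, and is zero otherwise. -/
noncomputable def truncGrading (α : ℕ) (j : ℤ) : Submodule K (TruncPoly K α) :=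
  if 0 ≤ j ∧ j < (α : ℤ) then Submodule.span K {tbar K α ^ j.toNat} else ⊥

end LefschetzPrelude

section PolyPrelude

variable (K : Type) [Field K] (n : ℕ)

/-- The subring `S = K[e₁, …, e_n]` of symmetric polynomials of
`R = K[x₁, …, x_n]`. -/
noncomputable def symS : Subalgebra K (MvPolynomial (Fin n) K) :=
  MvPolynomial.symmetricSubalgebra (Fin n) K

theorem mem_symS (p : MvPolynomial (Fin n) K) :
    p ∈ symS K n ↔ p.IsSymmetric :=
  MvPolynomial.mem_symmetricSubalgebra p

/-- The power sum `p_d = x₁^d + ⋯ + x_n^d`, as an element of `S`. -/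
noncomputable def psumS (d : ℕ) : ↥(symS K n) :=
  ⟨MvPolynomial.psum (Fin n) K d,
    (mem_symS K n _).mpr (MvPolynomial.psum_isSymmetric _ _ d)⟩

/-- The elementary symmetric polynomial `e_k`, as an element of `S`. -/
noncomputable def esymmS (k : ℕ) : ↥(symS K n) :=
  ⟨MvPolynomial.esymm (Fin n) K k,
    (mem_symS K n _).mpr (MvPolynomial.esymm_isSymmetric _ _ k)⟩

/-- The standard grading on a quotient `R/I` of the polynomial ring
`R = K[x₁, …, x_n]`: the degree-`d` piece is the image of the space of
homogeneous polynomials of degree `d`. -/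
noncomputable def quotGrading (I : Ideal (MvPolynomial (Fin n) K)) (d : ℕ) :
    Submodule K (MvPolynomial (Fin n) K ⧸ I) :=
  Submodule.map (Ideal.Quotient.mkₐ K I).toLinearMap
    (MvPolynomial.homogeneousSubmodule (Fin n) K d)

/-- The (non-standard) grading on a quotient `S/J` of the ring of symmetric
polynomials, `S_j = S ∩ R_j`: the degree-`d` piece is the image of
`S ∩ (homogeneous polynomials of degree d)`. -/
noncomputable def symQuotGrading (J : Ideal ↥(symS K n)) (d : ℕ) :
    Submodule K (↥(symS K n) ⧸ J) :=
  Submodule.map (Ideal.Quotient.mkₐ K J).toLinearMap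
    (Submodule.comap (symS K n).val.toLinearMap
      (MvPolynomial.homogeneousSubmodule (Fin n) K d))

end PolyPrelude

section Trinomial

open Polynomial

variable {K : Type} [Field K]

theorem natDegree_lt_of_iterate_derivative_eq_zero [CharZero K] {f : K[X]} {N : ℕ}
    (h : derivative^[N] f = 0) : f = 0 ∨ f.natDegree < N := by
  by_contra! hc
  obtain ⟨hf, hN⟩ := hc
  have h1 := congrArg (fun q => coeff q (f.natDegree - N)) h
  simp only [coeff_iterate_derivative, coeff_zero, Nat.sub_add_cancel hN, smul_eq_zero] at h1
  rcases h1 with h1 | h1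
  · rw [Nat.descFactorial_eq_zero_iff_lt] at h1
    omega
  · exact hf (leadingCoeff_eq_zero.mp h1)

theorem trinomial_injective [CharZero K] {α β γ e : ℕ} (hα : α ≤ e) (hβ : β ≤ e) (hγ : γ ≤ e)
    (hsum : α + β + γ = 2 * e + 2) {A B C : K[X]} (hA : A ∈ degreeLT K (e + 1 - α))
    (hB : B ∈ degreeLT K (e + 1 - β))
    (h : X ^ α * A + B + (X + 1) ^ γ * C = 0) : A = 0 ∧ B = 0 ∧ C = 0 := by
  rw [mem_degreeLT] at hA hB
  have hB0 : derivative^[e + 1 - β] B = 0 := iterate_derivative_eq_zero_of_degree_lt hB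
  have hD := congrArg (fun q => derivative^[e + 1 - β] q) h
  simp only [iterate_map_add, hB0, iterate_derivative_zero, add_zero] at hD
  have d1 : (X : K[X]) ^ (α - (e + 1 - β)) ∣ derivative^[e + 1 - β] (X ^ α * A) :=
    pow_sub_dvd_iterate_derivative_of_pow_dvd _ (dvd_mul_right _ _)
  have d2 : (X + 1 : K[X]) ^ (γ - (e + 1 - β)) ∣ derivative^[e + 1 - β] (X ^ α * A) := by
    rw [eq_neg_of_add_eq_zero_left hD, dvd_neg]
    exact pow_sub_dvd_iterate_derivative_of_pow_dvd _ (dvd_mul_right _ _)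
  have hcop : IsCoprime (X : K[X]) (X + 1) := ⟨-1, 1, by ring⟩
  have d3 := (hcop.pow (m := α - (e + 1 - β)) (n := γ - (e + 1 - β))).mul_dvd d1 d2
  have hXm : (X + 1 : K[X]).Monic := by simpa using monic_X_add_C (1 : K)
  have hz : derivative^[e + 1 - β] (X ^ α * A) = 0 := by
    by_contra hne
    have hA0 : A ≠ 0 := by
      rintro rfl
      simp at hne
    have hle := natDegree_le_of_dvd d3 hne
    rw [(monic_X_pow _).natDegree_mul (hXm.pow _), hXm.natDegree_pow, natDegree_X_pow,
      show (X + 1 : K[X]).natDegree = 1 by simpa using natDegree_X_add_C (1 : K)] at hle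
    have h2 := natDegree_iterate_derivative (X ^ α * A) (e + 1 - β)
    rw [(monic_X_pow _).natDegree_mul' hA0, natDegree_X_pow] at h2
    have h3 := (natDegree_lt_iff_degree_lt hA0).mpr hA
    omega
  have hA0 : A = 0 := by
    by_contra hA0
    rcases natDegree_lt_of_iterate_derivative_eq_zero hz with h1 | h1
    · exact hA0 (by simpa using h1)
    · rw [(monic_X_pow _).natDegree_mul' hA0, natDegree_X_pow] at h1
      omega
  have hC0 : C = 0 := by
    by_contra hC0
    rw [hz, zero_add] at hD
    rcases natDegree_lt_of_iterate_derivative_eq_zero hD with h1 | h1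
    · exact mul_ne_zero (hXm.pow _).ne_zero hC0 h1
    · rw [(hXm.pow _).natDegree_mul' hC0, hXm.natDegree_pow,
        show (X + 1 : K[X]).natDegree = 1 by simpa using natDegree_X_add_C (1 : K)] at h1
      omega
  subst hA0 hC0
  exact ⟨rfl, by simpa using h, rfl⟩

theorem finrank_degreeLT (m : ℕ) : Module.finrank K (degreeLT K m) = m := by
  simp [(degreeLTEquiv K m).finrank_eq]

theorem X_pow_mul_mem_degreeLT {a e : ℕ} (h : a ≤ e) {q A : K[X]} (hq : q.natDegree ≤ a)
    (hA : A ∈ degreeLT K (e + 1 - a)) : q * A ∈ degreeLT K (e + 1) := by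
  rw [mem_degreeLT] at hA ⊢
  by_cases hA0 : A = 0
  · simp [hA0]
  rw [← natDegree_lt_iff_degree_lt hA0] at hA
  by_cases hq0 : q * A = 0
  · simp [hq0]
  rw [← natDegree_lt_iff_degree_lt hq0]
  have := natDegree_mul_le (p := q) (q := A)
  omega

theorem trinomial_surjective [CharZero K] {α β γ e : ℕ} (hsum : α + β + γ = 2 * e + 2)
    {p : K[X]} (hp : p ∈ degreeLT K (e + 1)) :
    ∃ A ∈ degreeLT K (e + 1 - α), ∃ B ∈ degreeLT K (e + 1 - β), ∃ C ∈ degreeLT K (e + 1 - γ),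
      p = X ^ α * A + B + (X + 1) ^ γ * C := by
  have hX1 : (X + 1 : K[X]).natDegree = 1 := by simpa using natDegree_X_add_C (1 : K)
  have hXm : (X + 1 : K[X]).Monic := by simpa using monic_X_add_C (1 : K)
  have hdeg : (((X : K[X]) + 1) ^ γ).natDegree = γ := by rw [hXm.natDegree_pow, hX1, mul_one]
  have key : ∀ {q : K[X]} {m : ℕ}, q.Monic → q.natDegree = m → m ≤ e + 1 →
      p %ₘ q ∈ degreeLT K m ∧ p /ₘ q ∈ degreeLT K (e + 1 - m) := by
    intro q m hq hm hme
    constructor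
    · rw [mem_degreeLT]
      refine (degree_modByMonic_lt p hq).trans_le ?_
      rw [degree_eq_natDegree hq.ne_zero, hm]
    · rw [mem_degreeLT] at hp ⊢
      by_cases h0 : p /ₘ q = 0
      · simp [h0]
      have hp0 : p ≠ 0 := by rintro rfl; simp at h0
      rw [← natDegree_lt_iff_degree_lt h0, natDegree_divByMonic p hq, hm]
      rw [← natDegree_lt_iff_degree_lt hp0] at hp
      have : m ≤ p.natDegree := by
        by_contra hlt
        exact h0 ((divByMonic_eq_zero_iff hq).mpr (degree_lt_degree (by omega)))
      omega
  rcases Nat.lt_or_ge e α with hα | hα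
  · obtain ⟨h1, h2⟩ := key (hXm.pow γ) hdeg (by omega)
    exact ⟨0, zero_mem _, _, degreeLT_mono (by omega) h1, _, h2, by
      rw [mul_zero, zero_add, modByMonic_add_div p]⟩
  rcases Nat.lt_or_ge e γ with hγ | hγ
  · obtain ⟨h1, h2⟩ := key (monic_X_pow α) (natDegree_X_pow α) (by omega)
    exact ⟨_, h2, _, degreeLT_mono (by omega) h1, 0, zero_mem _, by
      rw [mul_zero, add_zero, add_comm, modByMonic_add_div p]⟩
  rcases Nat.lt_or_ge e β with hβ | hβ
  · have hcop : IsCoprime ((X : K[X]) ^ α) ((X + 1) ^ γ) :=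
      IsCoprime.pow ⟨-1, 1, by ring⟩
    obtain ⟨u, v, huv⟩ := hcop
    set C := (p * v) %ₘ (X ^ α) with hC
    have hCdeg : C ∈ degreeLT K α := by
      rw [mem_degreeLT]
      refine (degree_modByMonic_lt _ (monic_X_pow α)).trans_le ?_
      rw [degree_X_pow]
    have hC' : C ∈ degreeLT K (e + 1 - γ) := degreeLT_mono (by omega) hCdeg
    have hdvd : (X : K[X]) ^ α ∣ p - (X + 1) ^ γ * C := by
      refine ⟨p * u + (X + 1) ^ γ * ((p * v) /ₘ X ^ α), ?_⟩
      have h1 := modByMonic_add_div (p * v) (X ^ α : K[X])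
      have : C = p * v - X ^ α * ((p * v) /ₘ X ^ α) := by rw [hC]; linear_combination h1
      rw [this]
      linear_combination (- p) * huv
    obtain ⟨A, hA⟩ := hdvd
    refine ⟨A, ?_, 0, zero_mem _, C, hC', by linear_combination hA⟩
    have h2 : X ^ α * A ∈ degreeLT K (e + 1) := by
      rw [← hA]
      exact sub_mem hp (X_pow_mul_mem_degreeLT hγ hdeg.le hC')
    rw [mem_degreeLT] at h2 ⊢
    by_cases hA0 : A = 0
    · simp [hA0]
    rw [← natDegree_lt_iff_degree_lt hA0]
    rw [← natDegree_lt_iff_degree_lt (mul_ne_zero (monic_X_pow α).ne_zero hA0),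
      (monic_X_pow _).natDegree_mul' hA0, natDegree_X_pow] at h2
    omega
  let Φ : (degreeLT K (e + 1 - α) × degreeLT K (e + 1 - β) × degreeLT K (e + 1 - γ)) →ₗ[K]
      degreeLT K (e + 1) :=
    { toFun := fun t => ⟨X ^ α * t.1.1 + t.2.1.1 + (X + 1) ^ γ * t.2.2.1,
        add_mem (add_mem (X_pow_mul_mem_degreeLT hα (natDegree_X_pow α).le t.1.2)
          (degreeLT_mono (by omega) t.2.1.2)) (X_pow_mul_mem_degreeLT hγ hdeg.le t.2.2.2)⟩
      map_add' := fun s t => by ext1; simp; ring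
      map_smul' := fun r t => by ext1; simp [smul_add] }
  have hinj : Function.Injective Φ := by
    rw [← LinearMap.ker_eq_bot, LinearMap.ker_eq_bot']
    rintro ⟨⟨A, hA⟩, ⟨B, hB⟩, ⟨C, hC⟩⟩ h
    obtain ⟨h1, h2, h3⟩ := trinomial_injective hα hβ hγ hsum hA hB (congrArg Subtype.val h)
    subst h1 h2 h3
    rfl
  have : ∀ m, Module.Finite K (degreeLT K m) := fun m =>
    Module.Finite.equiv (degreeLTEquiv K m).symm
  have hsurj : Function.Surjective Φ := by
    rw [← LinearMap.injective_iff_surjective_of_finrank_eq_finrank]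
    · exact hinj
    · simp only [Module.finrank_prod, finrank_degreeLT]
      omega
  obtain ⟨⟨A, B, C⟩, h⟩ := hsurj ⟨p, hp⟩
  exact ⟨A, A.2, B, B.2, C, C.2, (congrArg Subtype.val h).symm⟩

theorem homogenize_mem_degreeLT {a e : ℕ} {A q : K[X]} (hA : A ∈ degreeLT K (e + 1 - a))
    (hq : q.natDegree ≤ a) :
    ∃ c : ℕ → K, (q * A).homogenize e = q.homogenize a *
      ∑ r ∈ Finset.range (e + 1 - a), c r • (MvPolynomial.X 0 ^ (e - a - r) *
        MvPolynomial.X 1 ^ r) := by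
  rcases Nat.lt_or_ge e a with h | h
  · refine ⟨0, ?_⟩
    rw [show e + 1 - a = 0 by omega, mem_degreeLT] at hA
    have : A = 0 := by
      by_contra h0
      rw [← natDegree_lt_iff_degree_lt h0] at hA
      omega
    simp [this]
  · have hA' : A.natDegree ≤ e - a := by
      by_cases h0 : A = 0
      · simp [h0]
      · rw [mem_degreeLT, ← natDegree_lt_iff_degree_lt h0] at hA
        omega
    refine ⟨fun r => A.coeff (e - a - r), ?_⟩
    rw [show (q * A).homogenize e = (q * A).homogenize (a + (e - a)) by
      rw [Nat.add_sub_cancel' h], homogenize_mul _ _ hq hA', show e + 1 - a = e - a + 1 by omega]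
    congr 1
    rw [← Finset.sum_range_reflect]
    conv_lhs => rw [A.as_sum_range' (e - a + 1) (by omega)]
    rw [homogenize_finsetSum]
    refine Finset.sum_congr rfl fun i hi => ?_
    rw [Finset.mem_range] at hi
    rw [homogenize_monomial (by omega), show e - a - (e - a + 1 - 1 - i) = i by omega,
      show e - a + 1 - 1 - i = e - a - i by omega, MvPolynomial.smul_eq_C_mul]
    rw [MvPolynomial.monomial_eq]
    simp
    rw [show e - a - (e - a - i) = i by omega]

/-- Homogeneous form of the strong Lefschetz property of `K[x, y] / (x ^ α, y ^ β)`: a monomial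
of degree `e` lies in the ideal `(x ^ α, y ^ β, (x + y) ^ γ)` whenever `α + β + γ = 2 * e + 2`. -/
theorem monomial_mem_trinomial_ideal [CharZero K] {α β γ e j k : ℕ}
    (hsum : α + β + γ = 2 * e + 2) (hjk : j + k = e) :
    ∃ a c : ℕ → K, ∀ (P : Type) [CommRing P] [Algebra K P] (x y : P), ∃ b : P,
      x ^ j * y ^ k =
        x ^ α * (∑ r ∈ Finset.range (e + 1 - α), a r • (x ^ (e - α - r) * y ^ r)) + y ^ β * b +
          (x + y) ^ γ * ∑ r ∈ Finset.range (e + 1 - γ), c r • (x ^ (e - γ - r) * y ^ r) := by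
  have hX1 : (X + 1 : K[X]).natDegree = 1 := by simpa using natDegree_X_add_C (1 : K)
  have hXm : (X + 1 : K[X]).Monic := by simpa using monic_X_add_C (1 : K)
  have hdeg : (((X : K[X]) + 1) ^ γ).natDegree ≤ γ := by rw [hXm.natDegree_pow, hX1, mul_one]
  obtain ⟨A, hA, B, hB, C, hC, h⟩ := trinomial_surjective hsum
    (p := (X : K[X]) ^ j) (mem_degreeLT.mpr (by rw [degree_X_pow]; exact_mod_cast (by omega : j < e + 1)))
  obtain ⟨a, ha⟩ := homogenize_mem_degreeLT hA (natDegree_X_pow (R := K) α).le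
  obtain ⟨b, hb⟩ := homogenize_mem_degreeLT (q := (1 : K[X])) hB (by simp)
  obtain ⟨c, hc⟩ := homogenize_mem_degreeLT hC hdeg
  have hpow : ((X + 1 : K[X]) ^ γ).homogenize γ =
      (MvPolynomial.X 0 + MvPolynomial.X 1) ^ γ := by
    have := homogenize_finsetProd (s := Finset.range γ) (p := fun _ => (X + 1 : K[X]))
      (n := fun _ => 1) (fun _ _ => hX1.le)
    simpa [homogenize_X, homogenize_one] using this
  have h2 := congrArg (fun q => homogenize q e) h
  simp only [homogenize_add] at h2
  rw [← one_mul B, ha, hb, hc, hpow, homogenize_X_pow (by omega), homogenize_X_pow le_rfl,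
    homogenize_one] at h2
  refine ⟨a, c, fun P _ _ x y => ?_⟩
  have h3 := congrArg (MvPolynomial.aeval ![x, y]) h2
  simp only [map_add, map_mul, map_pow, map_sum, map_smul, MvPolynomial.aeval_X,
    Matrix.cons_val_zero, Matrix.cons_val_one, Nat.sub_self, pow_zero, mul_one] at h3
  rw [show e - j = k by omega] at h3
  exact ⟨_, h3⟩

end Trinomial

section LinearAlgebra

variable {K V U : Type} [Field K] [AddCommGroup V] [Module K V] [AddCommGroup U] [Module K U]

/-- If `t • ψ t w ≡ ψ t u` modulo `T t` with `u` independent of `t`, then `ψ t` takes values in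
`T t` for all but finitely many `t`. -/
theorem finite_setOf_not_forall_mem [FiniteDimensional K U] (ψ : K → U →ₗ[K] V)
    (T : K → Submodule K V) (h : ∀ w, ∃ u, ∀ t, t • ψ t w - ψ t u ∈ T t) :
    {t | ¬ ∀ w, ψ t w ∈ T t}.Finite := by
  choose u hu using h
  let b := Module.finBasis K U
  let N : Module.End K U := b.constr K fun i => u (b i)
  have hN : ∀ t w, t • ψ t w - ψ t (N w) ∈ T t := by
    intro t w
    have : (⊤ : Submodule K U) ≤ (T t).comap (t • ψ t - ψ t ∘ₗ N) := by
      rw [← b.span_eq, Submodule.span_le]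
      rintro _ ⟨i, rfl⟩
      simpa [N, Module.Basis.constr_basis] using hu (b i) t
    exact this (Submodule.mem_top (x := w))
  refine (Module.End.finite_spectrum N).subset fun t ht => ?_
  by_contra hs
  refine ht fun w => ?_
  rw [spectrum.notMem_iff, Module.End.isUnit_iff] at hs
  obtain ⟨v, rfl⟩ := hs.2 w
  simpa [Module.algebraMap_end_apply] using hN t v

theorem finrank_add_finrank_inf_eq {A B M N : Submodule K V} [FiniteDimensional K A]
    [FiniteDimensional K B] (f : V →ₗ[K] V) (hAB : ∀ v ∈ A, f v ∈ B)
    (hsurj : ∀ w ∈ B, ∃ v ∈ A, w - f v ∈ N) (hker : ∀ v ∈ A, f v ∈ N ↔ v ∈ M) :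
    Module.finrank K A + Module.finrank K ↥(B ⊓ N) =
      Module.finrank K B + Module.finrank K ↥(A ⊓ M) := by
  let φ : A →ₗ[K] B ⧸ N.comap B.subtype :=
    (N.comap B.subtype).mkQ ∘ₗ (f.restrict hAB)
  have hφ : Function.Surjective φ := by
    intro y
    obtain ⟨⟨w, hw⟩, rfl⟩ := Submodule.mkQ_surjective _ y
    obtain ⟨v, hv, h⟩ := hsurj w hw
    refine ⟨⟨v, hv⟩, ?_⟩
    rw [← sub_eq_zero, ← neg_eq_zero, neg_sub]
    simp only [φ, LinearMap.comp_apply, ← map_sub]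
    rw [Submodule.mkQ_apply, Submodule.Quotient.mk_eq_zero]
    simpa using h
  have hkerφ : LinearMap.ker φ = M.comap A.subtype := by
    ext ⟨v, hv⟩
    simp only [φ, LinearMap.mem_ker, LinearMap.comp_apply, Submodule.mkQ_apply,
      Submodule.Quotient.mk_eq_zero, Submodule.mem_comap]
    exact hker v hv
  have h1 := φ.finrank_range_add_finrank_ker
  rw [LinearMap.range_eq_top.mpr hφ, finrank_top, hkerφ,
    ← Submodule.finrank_map_subtype_eq A, Submodule.map_comap_subtype] at h1
  have h2 := (N.comap B.subtype).finrank_quotient_add_finrank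
  rw [← Submodule.finrank_map_subtype_eq B, Submodule.map_comap_subtype] at h2
  omega

end LinearAlgebra

section CentralSimple

open DirectSum

variable {K R : Type} [Field K] [CommRing R] [Algebra K R] (𝒜 : ℕ → Submodule K R)

/-- The strong Lefschetz property of `R ⧸ I` with Lefschetz element `g` and socle degree `c`,
expressed in terms of homogeneous elements of `R`. -/
structure IsLefschetzMod (I : Ideal R) (c : ℕ) (g : R) : Prop where
  mem : g ∈ 𝒜 1
  inj : ∀ i, 2 * i ≤ c → ∀ v ∈ 𝒜 i, g ^ (c - 2 * i) * v ∈ I → v ∈ I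
  surj : ∀ i, 2 * i ≤ c → ∀ w ∈ 𝒜 (c - i), ∃ v ∈ 𝒜 i, w - g ^ (c - 2 * i) * v ∈ I
  top : ∀ i, c < i → ∀ v ∈ 𝒜 i, v ∈ I

variable {𝒜}

theorem mem_sup_span_singleton_homogeneous [GradedAlgebra 𝒜] {I : Ideal R}
    (hI : I.IsHomogeneous 𝒜) {z x : R} {m e : ℕ} (hz : z ∈ 𝒜 m) (hx : x ∈ 𝒜 e)
    (h : x ∈ I ⊔ Ideal.span {z}) :
    ∃ y ∈ I, y ∈ 𝒜 e ∧ (x = y ∨ m ≤ e ∧ ∃ u ∈ 𝒜 (e - m), x = y + z * u) := by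
  obtain ⟨y, hy, v, hv, rfl⟩ := Submodule.mem_sup.mp h
  obtain ⟨u, rfl⟩ := Ideal.mem_span_singleton'.mp hv
  have hx' : y + u * z = (decompose 𝒜 y e : R) + (decompose 𝒜 (z * u) e : R) := by
    conv_lhs => rw [← decompose_of_mem_same 𝒜 hx]
    simp [decompose_add, mul_comm]
  refine ⟨decompose 𝒜 y e, hI e hy, SetLike.coe_mem _, ?_⟩
  rcases le_or_gt m e with hme | hme
  · right
    refine ⟨hme, decompose 𝒜 u (e - m), SetLike.coe_mem _, ?_⟩
    rw [hx', coe_decompose_mul_of_left_mem_of_le 𝒜 hz hme]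
  · left
    rw [hx', coe_decompose_mul_of_left_mem_of_not_le 𝒜 hz (not_le.mpr hme), add_zero]

/-- Primitive decomposition. -/
theorem IsLefschetzMod.le_of_primitive_mem [SetLike.GradedMonoid 𝒜] {I : Ideal R} {c : ℕ} {g : R}
    (h : IsLefschetzMod 𝒜 I c g) {e : ℕ} (M : Submodule K R)
    (hM : ∀ x ∈ I, x ∈ 𝒜 e → x ∈ M)
    (hprim : ∀ a ≤ e, 2 * a ≤ c → ∀ p ∈ 𝒜 a, g ^ (c - 2 * a + 1) * p ∈ I →
      g ^ (e - a) * p ∈ M) : 𝒜 e ≤ M := by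
  have hgp : ∀ {i j v}, v ∈ 𝒜 i → g ^ j * v ∈ 𝒜 (j + i) := fun {i j v} hv =>
    SetLike.mul_mem_graded (by simpa using SetLike.pow_mem_graded j h.mem) hv
  have key : ∀ i j, 2 * i ≤ c → j + i = e → ∀ v ∈ 𝒜 i, g ^ j * v ∈ M := by
    intro i
    induction i with
    | zero =>
      intro j hi hj v hv
      have := hprim 0 (by omega) hi v hv (h.top (c + 1) (by omega) _ (hgp hv))
      rwa [show e - 0 = j by omega] at this
    | succ i ih =>
      intro j hi hj v hv
      obtain ⟨u, hu, h1⟩ := h.surj i (by omega) (g ^ (c - 2 * (i + 1) + 1) * v) (by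
        have := hgp (j := c - 2 * (i + 1) + 1) hv
        rwa [show c - 2 * (i + 1) + 1 + (i + 1) = c - i by omega] at this)
      have hp : v - g * u ∈ 𝒜 (i + 1) := by
        refine sub_mem hv ?_
        have := hgp (j := 1) hu
        rwa [pow_one, add_comm] at this
      have h2 := hprim (i + 1) (by omega) hi _ hp (by
        rw [show c - 2 * i = c - 2 * (i + 1) + 1 + 1 by omega, pow_succ] at h1
        convert h1 using 1
        ring)
      have h3 := ih (j + 1) (by omega) (by omega) u hu
      rw [show e - (i + 1) = j by omega] at h2
      convert add_mem h2 h3 using 1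
      ring
  intro w hw
  rcases Nat.lt_or_ge c e with hce | hce
  · exact hM w (h.top e hce w hw) hw
  rcases Nat.lt_or_ge c (2 * e) with he | he
  · obtain ⟨v, hv, h1⟩ := h.surj (c - e) (by omega) w (by
      rwa [show c - (c - e) = e by omega])
    have h2 := key (c - e) (c - 2 * (c - e)) (by omega) (by omega) v hv
    have h3 := hgp (j := c - 2 * (c - e)) hv
    rw [show c - 2 * (c - e) + (c - e) = e by omega] at h3
    have := add_mem (hM _ h1 (sub_mem hw h3)) h2
    simpa using this
  · simpa using key e 0 he (by omega) w hw

section Pencil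

variable (𝒜) in
/-- The map `(w_k)_k ↦ ∑ t ^ k z ^ k w_k` on families with `w_k` of degree `D - k`. -/
def pencilMap (z : R) (D : ℕ) (t : K) : ((k : Fin (D + 1)) → 𝒜 (D - k)) →ₗ[K] R :=
  ∑ k : Fin (D + 1), (t ^ (k : ℕ) • LinearMap.mulLeft K (z ^ (k : ℕ))) ∘ₗ
    (𝒜 (D - k)).subtype ∘ₗ LinearMap.proj k

theorem pencilMap_single (z : R) (D : ℕ) (t : K) (k : Fin (D + 1)) (x : 𝒜 (D - k)) :
    pencilMap 𝒜 z D t (Pi.single k x) = t ^ (k : ℕ) • (z ^ (k : ℕ) * (x : R)) := by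
  rw [pencilMap, LinearMap.sum_apply, Finset.sum_eq_single k]
  · simp
  · intro j _ hj
    simp [Pi.single_eq_of_ne hj]
  · simp

theorem exists_smul_pencilMap_sub_mem [CharZero K] [GradedAlgebra 𝒜] {I : Ideal R}
    (hI : I.IsHomogeneous 𝒜) {z g : R} (hz : z ∈ 𝒜 1) {c d i : ℕ} (hd : 0 < d) (hzd : z ^ d ∈ I)
    (h : IsLefschetzMod 𝒜 (I ⊔ Ideal.span {z}) c g) (hi : 2 * i ≤ c + d - 1) :
    ∀ w : (k : Fin (c + d - 1 - i + 1)) → 𝒜 (c + d - 1 - i - k), ∃ u, ∀ t : K, t • pencilMap 𝒜 z (c + d - 1 - i) t w - pencilMap 𝒜 z (c + d - 1 - i) t u ∈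
      (𝒜 i).map (LinearMap.mulLeft K ((g + t • z) ^ (c + d - 1 - 2 * i))) ⊔
        I.restrictScalars K := by
  set D := c + d - 1 - i with hD
  set m := c + d - 1 - 2 * i with hm
  let T : K → Submodule K R := fun t =>
    (𝒜 i).map (LinearMap.mulLeft K ((g + t • z) ^ m)) ⊔ I.restrictScalars K
  have hIT : ∀ {t x}, x ∈ I → x ∈ T t := fun hx => Submodule.mem_sup_right hx
  let Q : Submodule K ((k : Fin (D + 1)) → 𝒜 (D - k)) :=
    { carrier := {w | ∃ u, ∀ t : K, t • pencilMap 𝒜 z D t w - pencilMap 𝒜 z D t u ∈ T t}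
      zero_mem' := ⟨0, fun t => by simp⟩
      add_mem' := by
        rintro w w' ⟨u, hu⟩ ⟨u', hu'⟩
        refine ⟨u + u', fun t => ?_⟩
        convert add_mem (hu t) (hu' t) using 1
        simp only [map_add, smul_add]
        abel
      smul_mem' := by
        rintro s w ⟨u, hu⟩
        refine ⟨s • u, fun t => ?_⟩
        convert Submodule.smul_mem _ s (hu t) using 1
        simp only [map_smul, smul_sub, smul_comm s t] }
  suffices hQ : ∀ k x, Pi.single k x ∈ Q by
    intro w
    have : w ∈ Q := by
      rw [← Finset.univ_sum_single w]
      exact sum_mem fun k _ => hQ k _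
    exact this
  intro k
  let M : Submodule K R := (Q.comap (LinearMap.single K _ k)).map (𝒜 (D - k)).subtype
  suffices hM : 𝒜 (D - k) ≤ M by
    intro x
    obtain ⟨y, hy, hyx⟩ := hM x.2
    rwa [← Subtype.ext hyx]
  have hMmem : ∀ x (hx : x ∈ 𝒜 (D - k)),
      (∃ u, ∀ t : K, t • t ^ (k : ℕ) • (z ^ (k : ℕ) * x) - pencilMap 𝒜 z D t u ∈ T t) →
        x ∈ M := by
    rintro x hx ⟨u, hu⟩
    refine ⟨⟨x, hx⟩, ⟨u, fun t => ?_⟩, rfl⟩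
    rw [LinearMap.single_apply, pencilMap_single]
    exact hu t
  have hkD : (k : ℕ) ≤ D := by omega
  refine h.le_of_primitive_mem M (fun x hxI hx => hMmem x hx ?_) fun a ha hac p hp hgp => ?_
  · obtain ⟨y, hy, -, rfl | ⟨h1, u, hu, rfl⟩⟩ := mem_sup_span_singleton_homogeneous hI hz hx hxI
    · refine ⟨0, fun t => ?_⟩
      rw [map_zero, sub_zero]
      exact Submodule.smul_mem _ _ (Submodule.smul_mem _ _ (hIT (I.mul_mem_left _ hy)))
    · refine ⟨Pi.single ⟨k + 1, by omega⟩ ⟨u, by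
        simpa only [Nat.sub_sub] using hu⟩, fun t => ?_⟩
      rw [pencilMap_single]
      convert Submodule.smul_mem (T t) t (Submodule.smul_mem _ (t ^ (k : ℕ))
        (hIT (I.mul_mem_left (z ^ (k : ℕ)) hy))) using 1
      simp only [smul_smul, mul_add, smul_add, pow_succ, mul_comm t, mul_assoc]
      abel
  · have hgpow : ∀ {i j v}, v ∈ 𝒜 i → g ^ j * v ∈ 𝒜 (j + i) := fun {i j v} hv =>
      SetLike.mul_mem_graded (by simpa using SetLike.pow_mem_graded j h.mem) hv
    have hzpow : ∀ {i j v}, v ∈ 𝒜 i → z ^ j * v ∈ 𝒜 (j + i) := fun {i j v} hv =>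
      SetLike.mul_mem_graded (by simpa using SetLike.pow_mem_graded j hz) hv
    refine hMmem _ (by
      have := hgpow (j := D - k - a) hp
      rwa [show D - k - a + a = D - k by omega] at this) ?_
    obtain ⟨A, C, hAC⟩ := monomial_mem_trinomial_ideal (K := K) (α := c - 2 * a + 1) (β := d)
      (γ := m) (e := D - a) (j := D - k - a) (k := k) (by omega) (by omega)
    obtain ⟨q, hq, hqI⟩ : ∃ q ∈ 𝒜 (c - 2 * a + 1 + a - 1),
        g ^ (c - 2 * a + 1) * p - z * q ∈ I := by
      obtain ⟨y, hy, -, h2 | ⟨-, u, hu, h2⟩⟩ :=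
        mem_sup_span_singleton_homogeneous hI hz (hgpow hp) hgp
      · exact ⟨0, zero_mem _, by simpa [h2] using hy⟩
      · exact ⟨u, hu, by simpa [h2] using hy⟩
    have hdeg : ∀ r : ℕ, r < D - a + 1 - (c - 2 * a + 1) →
        A r • (g ^ (D - a - (c - 2 * a + 1) - r) * q) ∈ 𝒜 (D - (r + 1)) := by
      intro r hr
      have := hgpow (j := D - a - (c - 2 * a + 1) - r) hq
      rw [show D - a - (c - 2 * a + 1) - r + (c - 2 * a + 1 + a - 1) = D - (r + 1) by omega] at this
      exact Submodule.smul_mem _ _ this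
    refine ⟨∑ r : Fin (D - a + 1 - (c - 2 * a + 1)), Pi.single ⟨r + 1, by omega⟩
      ⟨_, hdeg r r.2⟩, fun t => ?_⟩
    obtain ⟨b, hb⟩ := hAC R g (t • z)
    have h3 : t ^ (k : ℕ) • (z ^ (k : ℕ) * (g ^ (D - k - a) * p)) =
        (∑ r ∈ Finset.range (D - a + 1 - (c - 2 * a + 1)),
          A r • (g ^ (D - a - (c - 2 * a + 1) - r) * (t • z) ^ r)) *
            (g ^ (c - 2 * a + 1) * p) + (t • z) ^ d * (b * p) +
        (g + t • z) ^ m * (∑ r ∈ Finset.range (D - a + 1 - m),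
          C r • (g ^ (D - a - m - r) * ((t • z) ^ r * p))) := by
      have : t ^ (k : ℕ) • (z ^ (k : ℕ) * (g ^ (D - k - a) * p)) =
          g ^ (D - k - a) * (t • z) ^ (k : ℕ) * p := by
        rw [smul_pow]
        simp only [Algebra.smul_def]
        ring
      rw [this, hb]
      simp only [← mul_assoc, ← smul_mul_assoc, ← Finset.sum_mul]
      ring
    have h4 : (g + t • z) ^ m * (∑ r ∈ Finset.range (D - a + 1 - m),
          C r • (g ^ (D - a - m - r) * ((t • z) ^ r * p))) ∈ T t := by
      refine Submodule.mem_sup_left ⟨_, sum_mem fun r hr => Submodule.smul_mem _ _ ?_, rfl⟩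
      rw [Finset.mem_range] at hr
      have := hgpow (j := D - a - m - r) (hzpow (j := r) hp)
      rw [show D - a - m - r + (r + a) = i by omega] at this
      rw [smul_pow, smul_mul_assoc, mul_smul_comm]
      exact Submodule.smul_mem _ _ this
    have h5 : (t • z) ^ d * (b * p) ∈ T t := by
      rw [smul_pow, smul_mul_assoc]
      exact Submodule.smul_mem _ _ (hIT (I.mul_mem_right _ hzd))
    have h6 : (∑ r ∈ Finset.range (D - a + 1 - (c - 2 * a + 1)),
          A r • (g ^ (D - a - (c - 2 * a + 1) - r) * (t • z) ^ r)) *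
            (g ^ (c - 2 * a + 1) * p - z * q) ∈ T t := hIT (I.mul_mem_left _ hqI)
    have h7 : pencilMap 𝒜 z D t (∑ r : Fin (D - a + 1 - (c - 2 * a + 1)),
        Pi.single ⟨r + 1, by omega⟩ ⟨_, hdeg r r.2⟩) =
        t • ((∑ r ∈ Finset.range (D - a + 1 - (c - 2 * a + 1)),
          A r • (g ^ (D - a - (c - 2 * a + 1) - r) * (t • z) ^ r)) * (z * q)) := by
      rw [map_sum, Finset.sum_mul, Finset.smul_sum, Finset.sum_range]
      refine Finset.sum_congr rfl fun r _ => ?_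
      rw [pencilMap_single, smul_pow]
      simp only [Algebra.smul_def, map_pow]
      ring
    rw [h3, h7]
    convert add_mem (Submodule.smul_mem _ t h4) (add_mem (Submodule.smul_mem _ t h5)
      (Submodule.smul_mem _ t h6)) using 1
    simp only [smul_add, mul_sub, smul_sub]
    abel

theorem finite_setOf_not_surjective [CharZero K] [GradedAlgebra 𝒜]
    [∀ i, FiniteDimensional K (𝒜 i)] {I : Ideal R}
    (hI : I.IsHomogeneous 𝒜) {z g : R} (hz : z ∈ 𝒜 1) {c d i : ℕ} (hd : 0 < d) (hzd : z ^ d ∈ I)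
    (h : IsLefschetzMod 𝒜 (I ⊔ Ideal.span {z}) c g) (hi : 2 * i ≤ c + d - 1) :
    {t : K | ¬ ∀ w ∈ 𝒜 (c + d - 1 - i), ∃ v ∈ 𝒜 i,
      w - (g + t • z) ^ (c + d - 1 - 2 * i) * v ∈ I}.Finite := by
  refine (finite_setOf_not_forall_mem _ _
    (exists_smul_pencilMap_sub_mem hI hz hd hzd h hi)).subset fun t ht hT => ht fun w hw => ?_
  have := hT (Pi.single 0 ⟨w, hw⟩)
  rw [pencilMap_single] at this
  simp only [Fin.val_zero, pow_zero, one_smul, one_mul] at this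
  obtain ⟨_, ⟨v, hv, rfl⟩, y, hy, h1⟩ := Submodule.mem_sup.mp this
  refine ⟨v, hv, ?_⟩
  rw [← h1]
  simpa using hy

end Pencil

section HilbertFunction

variable (𝒜) in
/-- The Hilbert function of `R ⧸ I`, extended by zero to negative degrees. -/
noncomputable def quotHilb (I : Ideal R) (s : ℤ) : ℤ :=
  if 0 ≤ s then (Module.finrank K (𝒜 s.toNat) : ℤ) -
    Module.finrank K ↥(𝒜 s.toNat ⊓ I.restrictScalars K) else 0

theorem quotHilb_natCast (I : Ideal R) (e : ℕ) :
    quotHilb 𝒜 I e = (Module.finrank K (𝒜 e) : ℤ) -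
      Module.finrank K ↥(𝒜 e ⊓ I.restrictScalars K) := by
  simp [quotHilb]

theorem quotHilb_of_neg (I : Ideal R) {s : ℤ} (hs : s < 0) : quotHilb 𝒜 I s = 0 := by
  simp [quotHilb, not_le.mpr hs]

theorem pow_mul_mem_graded [SetLike.GradedMonoid 𝒜] {g v : R} {i : ℕ} (hg : g ∈ 𝒜 1) (j : ℕ) (hv : v ∈ 𝒜 i) :
    g ^ j * v ∈ 𝒜 (j + i) :=
  SetLike.mul_mem_graded (by simpa using SetLike.pow_mem_graded j hg) hv

variable [∀ i, FiniteDimensional K (𝒜 i)]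

theorem quotHilb_natCast_eq_zero_iff (I : Ideal R) (e : ℕ) :
    quotHilb 𝒜 I e = 0 ↔ ∀ v ∈ 𝒜 e, v ∈ I := by
  rw [quotHilb_natCast, sub_eq_zero]
  constructor
  · intro h v hv
    have := Submodule.eq_of_le_of_finrank_eq (inf_le_left : 𝒜 e ⊓ I.restrictScalars K ≤ 𝒜 e)
      (by exact_mod_cast h.symm)
    exact (this.ge hv).2
  · intro h
    rw [inf_eq_left.mpr (show 𝒜 e ≤ I.restrictScalars K from h)]

variable [GradedAlgebra 𝒜]

theorem IsLefschetzMod.quotHilb_symm {I : Ideal R} {c : ℕ} {g : R}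
    (h : IsLefschetzMod 𝒜 I c g) (s : ℤ) : quotHilb 𝒜 I (c - s) = quotHilb 𝒜 I s := by
  have key : ∀ i : ℕ, 2 * i ≤ c → quotHilb 𝒜 I (c - i) = quotHilb 𝒜 I i := by
    intro i hi
    have := finrank_add_finrank_inf_eq (A := 𝒜 i) (B := 𝒜 (c - i)) (M := I.restrictScalars K)
      (N := I.restrictScalars K) (LinearMap.mulLeft K (g ^ (c - 2 * i)))
      (fun v hv => by
        have := pow_mul_mem_graded h.mem (c - 2 * i) hv
        rwa [show c - 2 * i + i = c - i by omega] at this)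
      (fun w hw => h.surj i hi w hw)
      (fun v hv => ⟨h.inj i hi v hv, fun hvI => I.mul_mem_left _ hvI⟩)
    rw [← Nat.cast_sub (by omega), quotHilb_natCast, quotHilb_natCast]
    omega
  have htop : ∀ s : ℤ, c < s → quotHilb 𝒜 I s = 0 := by
    intro s hs
    lift s to ℕ using by omega
    exact (quotHilb_natCast_eq_zero_iff I s).mpr (h.top s (by omega))
  rcases lt_or_ge s 0 with h0 | h0
  · rw [quotHilb_of_neg I h0, htop _ (by omega)]
  rcases lt_or_ge (c : ℤ) s with h1 | h1
  · rw [htop s h1, quotHilb_of_neg I (by omega)]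
  lift s to ℕ using h0
  rcases Nat.lt_or_ge c (2 * s) with h2 | h2
  · have := key (c - s) (by omega)
    rw [Nat.cast_sub (by omega), sub_sub_cancel] at this
    exact this.symm
  · exact key s h2

theorem finrank_inf_sup_span_pow {I : Ideal R} (hI : I.IsHomogeneous 𝒜) {z : R}
    (hz : z ∈ 𝒜 1) {d : ℕ}
    (hex : ∀ i ≤ d, ∀ u, z ^ i * u ∈ I → ∃ w, u - z ^ (d - i) * w ∈ I) {k : ℕ} (hk : k < d)
    (e : ℕ) :
    (Module.finrank K ↥(𝒜 e ⊓ (I ⊔ Ideal.span {z ^ k}).restrictScalars K) : ℤ) =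
      Module.finrank K ↥(𝒜 e ⊓ (I ⊔ Ideal.span {z ^ (k + 1)}).restrictScalars K) +
        quotHilb 𝒜 (I ⊔ Ideal.span {z}) (e - k) := by
  have hzk : ∀ k, z ^ k ∈ 𝒜 k := fun k => by simpa using SetLike.pow_mem_graded k hz
  rcases Nat.lt_or_ge e k with hek | hek
  · have hlow : ∀ k, e < k → 𝒜 e ⊓ (I ⊔ Ideal.span {z ^ k}).restrictScalars K =
        𝒜 e ⊓ I.restrictScalars K := by
      intro k hek
      refine le_antisymm (fun x hx => ⟨hx.1, ?_⟩) (inf_le_inf_left _ fun x hx =>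
        Ideal.mem_sup_left hx)
      obtain ⟨y, hy, -, rfl | ⟨h1, -⟩⟩ :=
        mem_sup_span_singleton_homogeneous hI (hzk k) hx.1 hx.2
      · exact hy
      · omega
    rw [hlow k hek, hlow (k + 1) (by omega), quotHilb_of_neg _ (by omega), add_zero]
  · have hle : I ⊔ Ideal.span {z ^ (k + 1)} ≤ I ⊔ Ideal.span {z ^ k} :=
      sup_le_sup_left (Ideal.span_singleton_le_span_singleton.mpr (pow_dvd_pow z (by omega))) _
    have := finrank_add_finrank_inf_eq (A := 𝒜 (e - k))
      (B := 𝒜 e ⊓ (I ⊔ Ideal.span {z ^ k}).restrictScalars K)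
      (M := (I ⊔ Ideal.span {z}).restrictScalars K)
      (N := (I ⊔ Ideal.span {z ^ (k + 1)}).restrictScalars K) (LinearMap.mulLeft K (z ^ k))
      (fun v hv => by
        refine ⟨?_, Ideal.mem_sup_right (Ideal.mul_mem_right _ _ (Ideal.mem_span_singleton_self _))⟩
        have := pow_mul_mem_graded hz k hv
        rwa [show k + (e - k) = e by omega] at this)
      (fun w hw => by
        obtain ⟨y, hy, -, rfl | ⟨-, u, hu, rfl⟩⟩ :=
          mem_sup_span_singleton_homogeneous hI (hzk k) hw.1 hw.2
        · exact ⟨0, zero_mem _, by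
            rw [map_zero, sub_zero]
            exact Ideal.mem_sup_left hy⟩
        · exact ⟨u, hu, by
            rw [LinearMap.mulLeft_apply, add_sub_cancel_right]
            exact Ideal.mem_sup_left hy⟩)
      (fun v hv => by
        simp only [LinearMap.mulLeft_apply, Submodule.restrictScalars_mem]
        constructor
        · intro h
          obtain ⟨y, hy, v', hv', h1⟩ := Submodule.mem_sup.mp h
          obtain ⟨u, rfl⟩ := Ideal.mem_span_singleton'.mp hv'
          obtain ⟨w, hw⟩ := hex k hk.le (v - z * u) (by
            convert hy using 1
            linear_combination -h1)
          have h2 : v = (v - z * u - z ^ (d - k) * w) + z * (u + z ^ (d - k - 1) * w) := by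
            rw [show d - k = d - k - 1 + 1 by omega, pow_succ]
            simp only [Nat.add_sub_cancel]
            ring
          rw [h2]
          exact add_mem (Ideal.mem_sup_left hw)
            (Ideal.mem_sup_right (Ideal.mul_mem_right _ _ (Ideal.mem_span_singleton_self _)))
        · intro h
          obtain ⟨y, hy, v', hv', rfl⟩ := Submodule.mem_sup.mp h
          obtain ⟨u, rfl⟩ := Ideal.mem_span_singleton'.mp hv'
          rw [mul_add]
          refine add_mem (Ideal.mem_sup_left (I.mul_mem_left _ hy)) (Ideal.mem_sup_right ?_)
          exact Ideal.mem_span_singleton'.mpr ⟨u, by ring⟩)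
    rw [inf_assoc, inf_eq_right.mpr (show Submodule.restrictScalars K
      (I ⊔ Ideal.span {z ^ (k + 1)}) ≤ Submodule.restrictScalars K (I ⊔ Ideal.span {z ^ k})
      from hle)] at this
    rw [← Nat.cast_sub hek, quotHilb_natCast]
    omega

theorem quotHilb_eq_sum {I : Ideal R} (hI : I.IsHomogeneous 𝒜) {z : R} (hz : z ∈ 𝒜 1) {d : ℕ}
    (hzd : z ^ d ∈ I)
    (hex : ∀ i ≤ d, ∀ u, z ^ i * u ∈ I → ∃ w, u - z ^ (d - i) * w ∈ I) (e : ℕ) :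
    quotHilb 𝒜 I e = ∑ k ∈ Finset.range d, quotHilb 𝒜 (I ⊔ Ideal.span {z}) (e - k) := by
  have key : ∀ j ≤ d, (Module.finrank K (𝒜 e) : ℤ) =
      Module.finrank K ↥(𝒜 e ⊓ (I ⊔ Ideal.span {z ^ j}).restrictScalars K) +
        ∑ k ∈ Finset.range j, quotHilb 𝒜 (I ⊔ Ideal.span {z}) (e - k) := by
    intro j
    induction j with
    | zero =>
      intro _
      have : 𝒜 e ⊓ (I ⊔ Ideal.span {z ^ 0}).restrictScalars K = 𝒜 e := by
        simp
      rw [this]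
      simp
    | succ j ih =>
      intro hj
      rw [ih (by omega), finrank_inf_sup_span_pow hI hz hex (by omega), Finset.sum_range_succ]
      ring
  rw [quotHilb_natCast, key d le_rfl, sup_eq_left.mpr]
  · ring
  · rwa [Ideal.span_singleton_le_iff_mem]

end HilbertFunction

/-- Central simple module argument: the strong Lefschetz property passes from
`R ⧸ (I + (z))` to `R ⧸ I` if `R ⧸ I` is free over `K[z] / (z ^ d)`. -/
theorem IsLefschetzMod.exists_of_sup_span_singleton [CharZero K] [GradedAlgebra 𝒜]
    [∀ i, FiniteDimensional K (𝒜 i)] {I : Ideal R} (hI : I.IsHomogeneous 𝒜) {z g : R}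
    (hz : z ∈ 𝒜 1) {c d : ℕ} (hd : 0 < d) (hzd : z ^ d ∈ I)
    (hex : ∀ i ≤ d, ∀ u, z ^ i * u ∈ I → ∃ w, u - z ^ (d - i) * w ∈ I)
    (h : IsLefschetzMod 𝒜 (I ⊔ Ideal.span {z}) c g) :
    ∃ g', IsLefschetzMod 𝒜 I (c + d - 1) g' := by
  have hfin : (⋃ i ∈ Finset.range (c + d), {t : K | 2 * i ≤ c + d - 1 ∧
      ¬ ∀ w ∈ 𝒜 (c + d - 1 - i), ∃ v ∈ 𝒜 i,
        w - (g + t • z) ^ (c + d - 1 - 2 * i) * v ∈ I}).Finite := by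
    refine Set.Finite.biUnion (Finset.finite_toSet _) fun i _ => ?_
    by_cases hi : 2 * i ≤ c + d - 1
    · simpa [hi] using finite_setOf_not_surjective hI hz hd hzd h hi
    · simp [hi]
  obtain ⟨t, ht⟩ := hfin.infinite_compl.nonempty
  have hsurj : ∀ i, 2 * i ≤ c + d - 1 → ∀ w ∈ 𝒜 (c + d - 1 - i), ∃ v ∈ 𝒜 i,
      w - (g + t • z) ^ (c + d - 1 - 2 * i) * v ∈ I := by
    intro i hi
    by_contra hcon
    refine ht (Set.mem_iUnion₂.mpr ⟨i, Finset.mem_range.mpr (by omega), hi, hcon⟩)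
  have hmem : g + t • z ∈ 𝒜 1 := add_mem h.mem (Submodule.smul_mem _ _ hz)
  have hsum := quotHilb_eq_sum hI hz hzd hex
  refine ⟨g + t • z, hmem, fun i hi v hv hvI => ?_, hsurj, fun i hi => ?_⟩
  · have hsymm : quotHilb 𝒜 I (c + d - 1 - i : ℕ) = quotHilb 𝒜 I i := by
      rw [hsum, hsum, ← Finset.sum_range_reflect]
      refine Finset.sum_congr rfl fun k hk => ?_
      rw [Finset.mem_range] at hk
      rw [← h.quotHilb_symm]
      congr 1
      omega
    have h1 := finrank_add_finrank_inf_eq (A := 𝒜 i) (B := 𝒜 (c + d - 1 - i))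
      (M := (I.restrictScalars K).comap
        (LinearMap.mulLeft K ((g + t • z) ^ (c + d - 1 - 2 * i))))
      (N := I.restrictScalars K) (LinearMap.mulLeft K ((g + t • z) ^ (c + d - 1 - 2 * i)))
      (fun v hv => by
        have := pow_mul_mem_graded hmem (c + d - 1 - 2 * i) hv
        rwa [show c + d - 1 - 2 * i + i = c + d - 1 - i by omega] at this)
      (fun w hw => hsurj i hi w hw) (fun v hv => Iff.rfl)
    rw [quotHilb_natCast, quotHilb_natCast] at hsymm
    have h2 := Submodule.eq_of_le_of_finrank_eq (S₁ := 𝒜 i ⊓ I.restrictScalars K)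
      (S₂ := 𝒜 i ⊓ (I.restrictScalars K).comap
        (LinearMap.mulLeft K ((g + t • z) ^ (c + d - 1 - 2 * i))))
      (inf_le_inf_left _ fun v hv => I.mul_mem_left _ hv) (by omega)
    exact (h2.ge ⟨hv, hvI⟩).2
  · rw [← quotHilb_natCast_eq_zero_iff, hsum]
    refine Finset.sum_eq_zero fun k hk => ?_
    rw [Finset.mem_range] at hk
    rw [← h.quotHilb_symm, quotHilb_of_neg]
    omega

theorem IsLefschetzMod.comap {R' : Type} [CommRing R'] [Algebra K R'] {𝒜' : ℕ → Submodule K R'}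
    {φ : R' →ₐ[K] R} (hφ : ∀ i, (𝒜' i).map φ.toLinearMap = 𝒜 i) {I : Ideal R} {c : ℕ} {g : R}
    (h : IsLefschetzMod 𝒜 I c g) : ∃ g', IsLefschetzMod 𝒜' (I.comap φ) c g' := by
  have hmem : ∀ {i v}, v ∈ 𝒜' i → φ v ∈ 𝒜 i := fun {i v} hv => hφ i ▸ ⟨v, hv, rfl⟩
  have hlift : ∀ {i v}, v ∈ 𝒜 i → ∃ v' ∈ 𝒜' i, φ v' = v := fun {i v} hv => by
    rw [← hφ i] at hv
    obtain ⟨v', hv', rfl⟩ := hv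
    exact ⟨v', hv', rfl⟩
  obtain ⟨g', hg', rfl⟩ := hlift h.mem
  refine ⟨g', hg', fun i hi v hv hvI => ?_, fun i hi w hw => ?_, fun i hi v hv => ?_⟩
  · exact h.inj i hi _ (hmem hv) (by simpa using hvI)
  · obtain ⟨v, hv, hvI⟩ := h.surj i hi _ (hmem hw)
    obtain ⟨u, hu, rfl⟩ := hlift hv
    exact ⟨u, hu, by simpa using hvI⟩
  · exact h.top i hi _ (hmem hv)

end CentralSimple

section Esymm

open MvPolynomial

attribute [local instance] MvPolynomial.gradedAlgebra

theorem Multiset.esymm_cons_succ {R : Type*} [CommSemiring R] (a : R) (s : Multiset R) (k : ℕ) :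
    (a ::ₘ s).esymm (k + 1) = s.esymm (k + 1) + a * s.esymm k := by
  simp [Multiset.esymm, Multiset.powersetCard_cons, Multiset.sum_map_mul_left]

theorem ringHom_esymm {σ Q P : Type*} [Fintype σ] [CommRing Q] [CommRing P]
    (f : MvPolynomial σ Q →+* P) (k : ℕ) :
    f (esymm σ Q k) = (Finset.univ.val.map fun i => f (X i)).esymm k := by
  rw [Finset.esymm_map_val]
  simp [esymm]

theorem ringHom_esymm_succ {n : ℕ} {Q Q' P : Type*} [CommRing Q] [CommRing Q'] [CommRing P]
    (f : MvPolynomial (Fin (n + 1)) Q →+* P) (f' : MvPolynomial (Fin n) Q' →+* P)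
    (h : ∀ i, f (X (Fin.succ i)) = f' (X i)) (k : ℕ) :
    f (esymm (Fin (n + 1)) Q (k + 1)) =
      f' (esymm (Fin n) Q' (k + 1)) + f (X 0) * f' (esymm (Fin n) Q' k) := by
  rw [ringHom_esymm, ringHom_esymm, ringHom_esymm, Fin.univ_val_map, Fin.univ_val_map,
    List.ofFn_succ, ← Multiset.cons_coe, Multiset.esymm_cons_succ]
  simp only [h]

theorem esymm_of_lt {n k : ℕ} {Q : Type*} [CommRing Q] (h : n < k) : esymm (Fin n) Q k = 0 := by
  rw [esymm, Finset.powersetCard_eq_empty.mpr (by simpa using h), Finset.sum_empty]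

/-- The ideal of `Q[x_1, …, x_n]` imposing `e_i = a_i` for all `i`. -/
noncomputable def esymmIdeal {Q : Type*} [CommRing Q] (n : ℕ) (a : ℕ → Q) :
    Ideal (MvPolynomial (Fin n) Q) :=
  Ideal.span (Set.range fun i => esymm (Fin n) Q i - C (a i))

theorem esymm_sub_mem_esymmIdeal {Q : Type*} [CommRing Q] {n : ℕ} (a : ℕ → Q) (i : ℕ) :
    esymm (Fin n) Q i - C (a i) ∈ esymmIdeal n a :=
  Ideal.subset_span ⟨i, rfl⟩

theorem esymmIdeal_le {Q : Type*} [CommRing Q] {n : ℕ} {a : ℕ → Q}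
    {I : Ideal (MvPolynomial (Fin n) Q)} (h : ∀ i, esymm (Fin n) Q i - C (a i) ∈ I) :
    esymmIdeal n a ≤ I := by
  rw [esymmIdeal, Ideal.span_le]
  rintro _ ⟨i, rfl⟩
  exact h i

/-- The polynomials `∑ j, (-X) ^ (i - j) * a j`. -/
noncomputable def signedHorner {Q : Type*} [CommRing Q] (a : ℕ → Q) : ℕ → Polynomial Q
  | 0 => 1
  | i + 1 => Polynomial.C (a (i + 1)) - Polynomial.X * signedHorner a i

theorem signedHorner_monic {Q : Type*} [CommRing Q] (a : ℕ → Q) (i : ℕ) :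
    ((-1) ^ i * signedHorner a i).Monic ∧ (signedHorner a i).natDegree ≤ i := by
  nontriviality Q
  have hdeg : ∀ i, (signedHorner a i).natDegree ≤ i := by
    intro i
    induction i with
    | zero => simp [signedHorner]
    | succ i ih =>
      rw [signedHorner]
      refine (Polynomial.natDegree_sub_le _ _).trans ?_
      have := Polynomial.natDegree_mul_le (p := (Polynomial.X : Polynomial Q))
        (q := signedHorner a i)
      rw [Polynomial.natDegree_X] at this
      simp
      omega
  refine ⟨?_, hdeg i⟩
  refine Polynomial.monic_of_natDegree_le_of_coeff_eq_one i ?_ ?_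
  · rcases neg_one_pow_eq_or (Polynomial Q) i with h | h <;> simpa [h] using hdeg i
  · have : ∀ i, (signedHorner a i).coeff i = (-1) ^ i := by
      intro i
      induction i with
      | zero => simp [signedHorner]
      | succ i ih =>
        rw [signedHorner, Polynomial.coeff_sub, Polynomial.coeff_X_mul, ih,
          Polynomial.coeff_C_succ]
        ring
    rw [show ((-1) ^ i : Polynomial Q) = Polynomial.C ((-1) ^ i) by simp,
      Polynomial.coeff_C_mul, this, ← mul_pow]
    simp

theorem mem_esymmIdeal_of_C_mul_mem (n : ℕ) : ∀ {Q : Type} [CommRing Q] {a : ℕ → Q},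
    a 0 = 1 → (∀ i, n < i → a i = 0) → ∀ {z : Q}, (∀ q, z * q = 0 → q = 0) →
      ∀ u, C z * u ∈ esymmIdeal n a → u ∈ esymmIdeal n a := by
  induction n with
  | zero =>
    intro Q _ a ha0 ha z hz u hu
    have hbot : esymmIdeal 0 a = ⊥ := by
      rw [eq_bot_iff]
      refine esymmIdeal_le fun i => ?_
      rcases Nat.eq_zero_or_pos i with rfl | hi
      · simp [ha0]
      · simp [ha i hi, esymm_of_lt hi]
    rw [hbot, Ideal.mem_bot] at hu ⊢
    rw [eq_C_of_isEmpty u, ← C_mul, C_eq_zero] at hu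
    rw [eq_C_of_isEmpty u, hz _ hu, C_0]
  | succ n ih =>
    intro Q _ a ha0 ha z hz u hu
    have ⟨hmonic, _⟩ := signedHorner_monic a (n + 1)
    set F := (-1) ^ (n + 1) * signedHorner a (n + 1) with hF
    set a' : ℕ → AdjoinRoot F := fun i => AdjoinRoot.mk F (signedHorner a i) with ha'
    have hrec : ∀ i, a' (i + 1) = algebraMap Q _ (a (i + 1)) - AdjoinRoot.root F * a' i := by
      intro i
      simp [ha', signedHorner, AdjoinRoot.algebraMap_eq]
    have ha'0 : a' 0 = 1 := by simp [ha', signedHorner]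
    have ha'n : ∀ i, n < i → a' i = 0 := by
      intro i hi
      induction i, hi using Nat.le_induction with
      | base =>
        rw [ha', AdjoinRoot.mk_eq_zero, hF]
        exact ⟨(-1) ^ (n + 1), by rw [mul_comm, ← mul_assoc, ← mul_pow]; simp⟩
      | succ i hi ih' => rw [hrec, ih', ha _ (by omega)]; simp
    have hz' : ∀ q : AdjoinRoot F, algebraMap Q _ z * q = 0 → q = 0 := by
      intro q hq
      have := hmonic.free_adjoinRoot
      let b := Module.Free.chooseBasis Q (AdjoinRoot F)
      refine b.repr.map_eq_zero_iff.mp ?_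
      ext i
      refine hz _ ?_
      rw [← Algebra.smul_def] at hq
      have := congrArg (fun v => b.repr v i) hq
      simpa using this
    let Φ : MvPolynomial (Fin (n + 1)) Q →+* MvPolynomial (Fin n) (AdjoinRoot F) :=
      eval₂Hom (C.comp (algebraMap Q _)) (Fin.cons (C (AdjoinRoot.root F)) X)
    have hΦC : ∀ q, Φ (C q) = C (algebraMap Q _ q) := fun q => by simp [Φ]
    have hΦ0 : Φ (X 0) = C (AdjoinRoot.root F) := by simp [Φ]
    have hΦs : ∀ i, Φ (X (Fin.succ i)) = X i := fun i => by simp [Φ]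
    have hΦI : esymmIdeal (n + 1) a ≤ (esymmIdeal n a').comap Φ := by
      refine esymmIdeal_le fun i => ?_
      rw [Ideal.mem_comap]
      cases i with
      | zero => simp [ha0]
      | succ i =>
        rw [map_sub, ringHom_esymm_succ Φ (RingHom.id _) hΦs, hΦC, hΦ0]
        have h1 := esymm_sub_mem_esymmIdeal (n := n) a' (i + 1)
        have h2 := (esymmIdeal n a').mul_mem_left (C (AdjoinRoot.root F))
          (esymm_sub_mem_esymmIdeal (n := n) a' i)
        convert add_mem h1 h2 using 1
        simp only [hrec, C_sub, C_mul, RingHom.id_apply]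
        ring
    let π := Ideal.Quotient.mk (esymmIdeal (n + 1) a)
    let s : MvPolynomial (Fin n) Q →+* MvPolynomial (Fin (n + 1)) Q :=
      (rename Fin.succ).toRingHom
    have hs : ∀ i, RingHom.id _ (X (Fin.succ i)) = s (X i) := fun i => by simp [s]
    have hG : ∀ i, Polynomial.eval₂ (π.comp C) (π (X 0)) (signedHorner a i) =
        π (s (esymm (Fin n) Q i)) := by
      intro i
      induction i with
      | zero => simp [signedHorner]
      | succ i ih' =>
        rw [signedHorner, Polynomial.eval₂_sub, Polynomial.eval₂_mul, ih', Polynomial.eval₂_C,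
          Polynomial.eval₂_X]
        have h1 := ringHom_esymm_succ (RingHom.id _) s hs i
        have h2 : π (esymm (Fin (n + 1)) Q (i + 1)) = π (C (a (i + 1))) :=
          (Ideal.Quotient.mk_eq_mk_iff_sub_mem _ _).mpr (esymm_sub_mem_esymmIdeal _ _)
        simp only [RingHom.id_apply] at h1
        rw [RingHom.comp_apply, ← h2, h1, map_add, map_mul]
        ring
    let ℓ : AdjoinRoot F →+* _ := AdjoinRoot.lift (π.comp C) (π (X 0)) (by
      rw [hF, Polynomial.eval₂_mul, hG, esymm_of_lt (Nat.lt_succ_self n)]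
      simp)
    let Ψ : MvPolynomial (Fin n) (AdjoinRoot F) →+* _ :=
      eval₂Hom ℓ fun i => π (X (Fin.succ i))
    have hΨΦ : Ψ.comp Φ = π := by
      refine ringHom_ext (fun q => ?_) fun i => ?_
      · simp [Ψ, Φ, ℓ, AdjoinRoot.algebraMap_eq]
      · refine Fin.cases ?_ (fun i => ?_) i
        · simp [Ψ, Φ, ℓ]
        · simp [Ψ, Φ]
    have hΨI : esymmIdeal n a' ≤ RingHom.ker Ψ := by
      refine esymmIdeal_le fun i => ?_
      have h1 : Ψ (esymm (Fin n) (AdjoinRoot F) i) = π (s (esymm (Fin n) Q i)) := by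
        rw [ringHom_esymm, ← RingHom.comp_apply, ringHom_esymm]
        simp [Ψ, s]
      have h2 : Ψ (C (a' i)) = Polynomial.eval₂ (π.comp C) (π (X 0)) (signedHorner a i) := by
        simp [Ψ, ha', ℓ]
      rw [RingHom.mem_ker, map_sub, h1, h2, hG, sub_self]
    have h1 := hΦI hu
    rw [Ideal.mem_comap, map_mul, hΦC] at h1
    have h2 := hΨI (ih ha'0 ha'n hz' _ h1)
    rw [RingHom.mem_ker, ← RingHom.comp_apply, hΨΦ] at h2
    exact Ideal.Quotient.eq_zero_iff_mem.mp h2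

section Coinvariants

variable {K : Type} [Field K]

variable (K) in
/-- The ideal generated by the symmetric polynomials of positive degree. -/
noncomputable def coinvariantIdeal (n : ℕ) : Ideal (MvPolynomial (Fin n) K) :=
  esymmIdeal n fun i => if i = 0 then 1 else 0

theorem esymm_succ_mem_coinvariantIdeal (n i : ℕ) :
    esymm (Fin n) K (i + 1) ∈ coinvariantIdeal K n := by
  simpa [coinvariantIdeal] using
    esymm_sub_mem_esymmIdeal (n := n) (fun i => if i = 0 then (1 : K) else 0) (i + 1)

theorem coinvariantIdeal_le {n : ℕ} {I : Ideal (MvPolynomial (Fin n) K)}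
    (h : ∀ i, esymm (Fin n) K (i + 1) ∈ I) : coinvariantIdeal K n ≤ I := by
  refine esymmIdeal_le fun i => ?_
  cases i with
  | zero => simp
  | succ i => simpa using h i

theorem esymm_succ_eq_rename (n i : ℕ) : esymm (Fin (n + 1)) K (i + 1) =
    rename Fin.succ (esymm (Fin n) K (i + 1)) + X 0 * rename Fin.succ (esymm (Fin n) K i) :=
  ringHom_esymm_succ (RingHom.id (MvPolynomial (Fin (n + 1)) K))
    (rename (R := K) (Fin.succ (n := n))).toRingHom (by simp) i

theorem rename_esymm_sub_mem_coinvariantIdeal (n i : ℕ) :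
    rename Fin.succ (esymm (Fin n) K i) - (-X 0) ^ i ∈ coinvariantIdeal K (n + 1) := by
  induction i with
  | zero => simp
  | succ i ih =>
    convert sub_mem (esymm_succ_mem_coinvariantIdeal (K := K) (n + 1) i)
      (Ideal.mul_mem_left _ (X 0) ih) using 1
    rw [esymm_succ_eq_rename]
    ring

theorem X_zero_pow_mem_coinvariantIdeal (n : ℕ) :
    X 0 ^ (n + 1) ∈ coinvariantIdeal K (n + 1) := by
  have := rename_esymm_sub_mem_coinvariantIdeal (K := K) n (n + 1)
  rw [esymm_of_lt (Nat.lt_succ_self n), map_zero, zero_sub, neg_mem_iff, neg_pow] at this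
  rcases neg_one_pow_eq_or (MvPolynomial (Fin (n + 1)) K) (n + 1) with h | h <;>
    simpa [h] using this

theorem exists_sub_X_zero_pow_mul_mem_coinvariantIdeal (n : ℕ) {i : ℕ} (hi : i ≤ n + 1)
    (u : MvPolynomial (Fin (n + 1)) K) (hu : X 0 ^ i * u ∈ coinvariantIdeal K (n + 1)) :
    ∃ w, u - X 0 ^ (n + 1 - i) * w ∈ coinvariantIdeal K (n + 1) := by
  let a : ℕ → Polynomial K := fun i => if i ≤ n then (-Polynomial.X) ^ i else 0
  let Φ : MvPolynomial (Fin (n + 1)) K →+* MvPolynomial (Fin n) (Polynomial K) :=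
    eval₂Hom (C.comp Polynomial.C) (Fin.cons (C Polynomial.X) X)
  let Ψ : MvPolynomial (Fin n) (Polynomial K) →+* MvPolynomial (Fin (n + 1)) K :=
    eval₂Hom (Polynomial.eval₂RingHom C (X 0)) fun i => X (Fin.succ i)
  have hΦ0 : Φ (X 0) = C Polynomial.X := by simp [Φ]
  have hΨΦ : Ψ.comp Φ = RingHom.id _ := by
    refine ringHom_ext (fun q => by simp [Ψ, Φ]) fun i => ?_
    refine Fin.cases ?_ (fun i => ?_) i <;> simp [Ψ, Φ]
  have hΦI : coinvariantIdeal K (n + 1) ≤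
      (esymmIdeal n a ⊔ Ideal.span {C Polynomial.X ^ (n + 1)}).comap Φ := by
    refine coinvariantIdeal_le fun i => ?_
    rw [Ideal.mem_comap, ringHom_esymm_succ Φ (RingHom.id _) (by simp [Φ]), hΦ0]
    have h1 := add_mem (esymm_sub_mem_esymmIdeal (n := n) a (i + 1))
      ((esymmIdeal n a).mul_mem_left (C Polynomial.X) (esymm_sub_mem_esymmIdeal (n := n) a i))
    have h2 : C (a (i + 1)) + C Polynomial.X * C (a i) ∈
        Ideal.span {(C Polynomial.X ^ (n + 1) : MvPolynomial (Fin n) (Polynomial K))} := by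
      rw [Ideal.mem_span_singleton]
      simp only [a]
      rcases lt_trichotomy i n with h | rfl | h
      · rw [if_pos (by omega), if_pos (by omega)]
        simp only [C_pow, C_neg]
        exact ⟨0, by ring⟩
      · rw [if_neg (by omega), if_pos le_rfl]
        simp only [C_pow, C_neg, C_0]
        exact ⟨(-1) ^ i, by ring⟩
      · rw [if_neg (by omega), if_neg (by omega)]
        simp
    convert add_mem (Ideal.mem_sup_left h1) (Ideal.mem_sup_right h2) using 1
    simp only [RingHom.id_apply]
    ring
  have hΨI : esymmIdeal n a ≤ (coinvariantIdeal K (n + 1)).comap Ψ := by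
    refine esymmIdeal_le fun i => ?_
    rw [Ideal.mem_comap, map_sub]
    have h1 : Ψ (esymm (Fin n) (Polynomial K) i) = rename Fin.succ (esymm (Fin n) K i) := by
      rw [ringHom_esymm, ← AlgHom.coe_toRingHom, ringHom_esymm]
      simp [Ψ]
    rw [h1]
    simp only [a]
    split_ifs with h
    · convert rename_esymm_sub_mem_coinvariantIdeal (K := K) n i using 2
      simp [Ψ]
    · rw [esymm_of_lt (not_le.mp h)]
      simp
  obtain ⟨y, hy, v, hv, h⟩ := Submodule.mem_sup.mp (hΦI hu)
  obtain ⟨w, rfl⟩ := Ideal.mem_span_singleton'.mp hv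
  have hcancel : Φ u - C Polynomial.X ^ (n + 1 - i) * w ∈ esymmIdeal n a := by
    refine mem_esymmIdeal_of_C_mul_mem n (a := a) (z := Polynomial.X ^ i) (by simp [a])
      (fun j hj => if_neg (not_le.mpr hj)) (fun q hq => ?_) _ ?_
    · exact (mul_eq_zero.mp hq).resolve_left (pow_ne_zero _ Polynomial.X_ne_zero)
    · convert hy using 1
      rw [map_mul, map_pow, hΦ0] at h
      rw [C_pow, mul_sub, ← h, ← mul_assoc, ← pow_add, Nat.add_sub_cancel' hi]
      ring
  refine ⟨Ψ w, ?_⟩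
  have := hΨI hcancel
  rw [Ideal.mem_comap, map_sub, ← RingHom.comp_apply, hΨΦ] at this
  simpa [Ψ] using this

variable (K) in
/-- The substitution `X 0 ↦ 0`, `X (i + 1) ↦ X i`. -/
noncomputable def evalZero (n : ℕ) :
    MvPolynomial (Fin (n + 1)) K →ₐ[K] MvPolynomial (Fin n) K :=
  aeval (Fin.cons 0 X)

theorem comap_evalZero_coinvariantIdeal (n : ℕ) :
    (coinvariantIdeal K n).comap (evalZero K n) =
      coinvariantIdeal K (n + 1) ⊔ Ideal.span {X 0} := by
  have hr : ∀ p, evalZero K n (rename Fin.succ p) = p := by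
    intro p
    rw [evalZero, aeval_rename]
    simp [Function.comp_def]
  refine le_antisymm (fun u hu => ?_) (sup_le (coinvariantIdeal_le fun i => ?_) ?_)
  · have h1 : coinvariantIdeal K n ≤
        (coinvariantIdeal K (n + 1) ⊔ Ideal.span {X 0}).comap (rename Fin.succ) := by
      refine coinvariantIdeal_le fun i => ?_
      rw [Ideal.mem_comap]
      have h := esymm_succ_eq_rename (K := K) n i
      rw [← sub_eq_iff_eq_add] at h
      rw [← h]
      exact sub_mem (Ideal.mem_sup_left (esymm_succ_mem_coinvariantIdeal _ _))
        (Ideal.mem_sup_right (Ideal.mul_mem_right _ _ (Ideal.mem_span_singleton_self _)))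
    have h2 : (Ideal.Quotient.mkₐ K (Ideal.span {X 0})).comp
        ((rename Fin.succ).comp (evalZero K n)) = Ideal.Quotient.mkₐ K (Ideal.span {X 0}) := by
      refine algHom_ext fun i => ?_
      refine Fin.cases ?_ (fun i => ?_) i
      · simp [evalZero, Ideal.Quotient.eq_zero_iff_mem.mpr (Ideal.mem_span_singleton_self _)]
      · simp [evalZero]
    have h3 := Ideal.Quotient.eq.mp (DFunLike.congr_fun h2 u)
    have h4 := h1 hu
    rw [Ideal.mem_comap] at h4
    convert sub_mem h4 (Ideal.mem_sup_right h3) using 1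
    simp
  · rw [Ideal.mem_comap, esymm_succ_eq_rename, map_add, hr]
    convert esymm_succ_mem_coinvariantIdeal n i
    simp [evalZero]
  · rw [Ideal.span_singleton_le_iff_mem, Ideal.mem_comap]
    simp [evalZero]

theorem map_evalZero_homogeneousSubmodule (n i : ℕ) :
    (homogeneousSubmodule (Fin (n + 1)) K i).map (evalZero K n).toLinearMap =
      homogeneousSubmodule (Fin n) K i := by
  ext p
  constructor
  · rintro ⟨q, hq, rfl⟩
    have := IsHomogeneous.aeval (S := K) (n := 1)
      (show q.IsHomogeneous i from hq) (Fin.cons 0 X : Fin (n + 1) → MvPolynomial (Fin n) K)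
      (fun i => by
        refine Fin.cases ?_ (fun i => ?_) i
        · exact isHomogeneous_zero _ _ _
        · exact isHomogeneous_X _ _)
    rwa [one_mul] at this
  · intro hp
    refine ⟨rename Fin.succ p, (show p.IsHomogeneous i from hp).rename_isHomogeneous, ?_⟩
    rw [AlgHom.toLinearMap_apply, evalZero, aeval_rename]
    simp [Function.comp_def]

theorem esymm_mem_homogeneousSubmodule (n i : ℕ) :
    esymm (Fin n) K i ∈ homogeneousSubmodule (Fin n) K i :=
  IsHomogeneous.sum _ _ _ fun t ht => by
    have := IsHomogeneous.prod t (fun i => (X i : MvPolynomial (Fin n) K)) (fun _ => 1)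
      fun i _ => isHomogeneous_X K i
    simpa [(Finset.mem_powersetCard.mp ht).2] using this

theorem finiteDimensional_homogeneousSubmodule (n i : ℕ) :
    FiniteDimensional K (homogeneousSubmodule (Fin n) K i) :=
  Module.Finite.iff_fg.mpr (homogeneousSubmodule_fg _ _ _)

theorem coinvariantIdeal_isHomogeneous (n : ℕ) :
    (coinvariantIdeal K n).IsHomogeneous (homogeneousSubmodule (Fin n) K) := by
  refine Ideal.homogeneous_span _ _ ?_
  rintro _ ⟨i, rfl⟩
  refine ⟨i, ?_⟩
  cases i with
  | zero => simp
  | succ i => simpa using esymm_mem_homogeneousSubmodule n (i + 1)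

theorem IsLefschetzMod.coinvariantIdeal_succ [CharZero K] {n c : ℕ} {g : MvPolynomial (Fin n) K}
    (h : IsLefschetzMod (homogeneousSubmodule (Fin n) K) (coinvariantIdeal K n) c g) :
    ∃ c g, IsLefschetzMod (homogeneousSubmodule (Fin (n + 1)) K) (coinvariantIdeal K (n + 1)) c
      g := by
  have := finiteDimensional_homogeneousSubmodule (K := K) (n + 1)
  obtain ⟨g', h'⟩ := h.comap (map_evalZero_homogeneousSubmodule n)
  have h2 : IsLefschetzMod (homogeneousSubmodule (Fin (n + 1)) K)
      (coinvariantIdeal K (n + 1) ⊔ Ideal.span {X 0}) c g' := by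
    rw [← comap_evalZero_coinvariantIdeal]
    exact h'
  have hX : (X 0 : MvPolynomial (Fin (n + 1)) K) ∈ homogeneousSubmodule (Fin (n + 1)) K 1 :=
    isHomogeneous_X _ _
  exact ⟨_, IsLefschetzMod.exists_of_sup_span_singleton (I := coinvariantIdeal K (n + 1))
    (coinvariantIdeal_isHomogeneous (n + 1)) (z := X 0) hX (d := n + 1) n.succ_pos
    (X_zero_pow_mem_coinvariantIdeal n)
    (fun i hi u hu => exists_sub_X_zero_pow_mul_mem_coinvariantIdeal n hi u hu) h2⟩

/-- The coinvariant algebra of the symmetric group has the strong Lefschetz property. -/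
theorem exists_isLefschetzMod_coinvariantIdeal [CharZero K] (n : ℕ) :
    ∃ c g, IsLefschetzMod (homogeneousSubmodule (Fin n) K) (coinvariantIdeal K n) c g := by
  induction n with
  | zero =>
    refine ⟨0, 0, zero_mem _, fun i hi v hv h => ?_, fun i hi w hw => ⟨w, ?_, ?_⟩,
      fun i hi v hv => ?_⟩
    · simpa using h
    · rwa [show i = 0 by omega] at hw ⊢
    · simp
    · have h1 : v.IsHomogeneous i := hv
      have h2 : v = 0 := by
        by_contra h0
        exact hi.ne (IsHomogeneous.inj_right (isHomogeneous_of_isEmpty _ _ v) h1 h0)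
      rw [h2]
      exact zero_mem _
  | succ n ih =>
    obtain ⟨c, g, h⟩ := ih
    exact h.coinvariantIdeal_succ

end Coinvariants

section PowerIdeal

variable {K : Type} [Field K]

/-- The ideal imposing `e_i = c_i e_1 ^ i` for all `i`. -/
noncomputable def esymmPowIdeal (n : ℕ) (c : ℕ → K) : Ideal (MvPolynomial (Fin n) K) :=
  Ideal.span (Set.range fun i => esymm (Fin n) K i - C (c i) * esymm (Fin n) K 1 ^ i)

theorem esymm_sub_mem_esymmPowIdeal {n : ℕ} (c : ℕ → K) (i : ℕ) :
    esymm (Fin n) K i - C (c i) * esymm (Fin n) K 1 ^ i ∈ esymmPowIdeal n c :=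
  Ideal.subset_span ⟨i, rfl⟩

theorem esymmPowIdeal_le {n : ℕ} {c : ℕ → K} {I : Ideal (MvPolynomial (Fin n) K)}
    (h : ∀ i, esymm (Fin n) K i - C (c i) * esymm (Fin n) K 1 ^ i ∈ I) :
    esymmPowIdeal n c ≤ I := by
  rw [esymmPowIdeal, Ideal.span_le]
  rintro _ ⟨i, rfl⟩
  exact h i

theorem mem_esymmPowIdeal_of_esymm_one_mul_mem {n : ℕ} {c : ℕ → K} (h0 : c 0 = 1) (h1 : c 1 = 1)
    (hc : ∀ i, n < i → c i = 0) {u : MvPolynomial (Fin n) K} {j : ℕ}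
    (hu : esymm (Fin n) K 1 ^ j * u ∈ esymmPowIdeal n c) : u ∈ esymmPowIdeal n c := by
  let a : ℕ → Polynomial K := fun i => Polynomial.C (c i) * Polynomial.X ^ i
  let ι : MvPolynomial (Fin n) K →+* MvPolynomial (Fin n) (Polynomial K) := map Polynomial.C
  let ρ : MvPolynomial (Fin n) (Polynomial K) →+* MvPolynomial (Fin n) K :=
    eval₂Hom (Polynomial.eval₂RingHom C (esymm (Fin n) K 1)) X
  have hρι : ρ.comp ι = RingHom.id _ :=
    ringHom_ext (fun q => by simp [ρ, ι]) fun i => by simp [ρ, ι]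
  have hι : ∀ i, ι (esymm (Fin n) K i) = esymm (Fin n) _ i := fun i => map_esymm _ _ _ _
  have hι1 : esymm (Fin n) (Polynomial K) 1 - C Polynomial.X ∈ esymmIdeal n a := by
    simpa [a, h1] using esymm_sub_mem_esymmIdeal (n := n) a 1
  have hpow : ∀ i, esymm (Fin n) (Polynomial K) 1 ^ i - C Polynomial.X ^ i ∈ esymmIdeal n a :=
    fun i => Ideal.mem_of_dvd _ (sub_dvd_pow_sub_pow _ _ i) hι1
  have hιI : esymmPowIdeal n c ≤ (esymmIdeal n a).comap ι := by
    refine esymmPowIdeal_le fun i => ?_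
    rw [Ideal.mem_comap, map_sub, map_mul, map_pow, hι, hι]
    convert sub_mem (esymm_sub_mem_esymmIdeal (n := n) a i)
      (Ideal.mul_mem_left _ (C (Polynomial.C (c i))) (hpow i)) using 1
    simp only [a, ι, map_C, C_mul, C_pow]
    ring
  have hρI : esymmIdeal n a ≤ (esymmPowIdeal n c).comap ρ := by
    refine esymmIdeal_le fun i => ?_
    rw [Ideal.mem_comap, map_sub]
    convert esymm_sub_mem_esymmPowIdeal (n := n) c i using 2
    · have := hι i
      rw [← this, ← RingHom.comp_apply, hρι, RingHom.id_apply]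
    · simp [ρ, a]
  have key : ι u ∈ esymmIdeal n a := by
    refine mem_esymmIdeal_of_C_mul_mem n (a := a) (z := Polynomial.X ^ j) (by simp [a, h0])
      (fun i hi => by simp [a, hc i hi])
      (fun q hq => (mul_eq_zero.mp hq).resolve_left (pow_ne_zero _ Polynomial.X_ne_zero)) _ ?_
    have h2 := hιI hu
    rw [Ideal.mem_comap, map_mul, map_pow, hι] at h2
    convert sub_mem h2 (Ideal.mul_mem_left _ (ι u) (hpow j)) using 1
    rw [C_pow]
    ring
  have h3 := hρI key
  rwa [Ideal.mem_comap, ← RingHom.comp_apply, hρι] at h3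

theorem esymmPowIdeal_sup_span (n : ℕ) {c : ℕ → K} (h0 : c 0 = 1) {d : ℕ} (hd : 0 < d) :
    esymmPowIdeal n c ⊔ Ideal.span {esymm (Fin n) K 1 ^ d} ⊔ Ideal.span {esymm (Fin n) K 1} =
      coinvariantIdeal K n := by
  refine le_antisymm (sup_le (sup_le (esymmPowIdeal_le fun i => ?_) ?_) ?_)
    (coinvariantIdeal_le fun i => ?_)
  · cases i with
    | zero => simp [h0]
    | succ i =>
      exact sub_mem (esymm_succ_mem_coinvariantIdeal n i) (Ideal.mul_mem_left _ _
        (Ideal.pow_mem_of_mem _ (esymm_succ_mem_coinvariantIdeal n 0) _ i.succ_pos))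
  · rw [Ideal.span_singleton_le_iff_mem]
    exact Ideal.pow_mem_of_mem _ (esymm_succ_mem_coinvariantIdeal n 0) _ hd
  · rw [Ideal.span_singleton_le_iff_mem]
    exact esymm_succ_mem_coinvariantIdeal n 0
  · have h1 := Ideal.mem_sup_left (T := Ideal.span {esymm (Fin n) K 1})
      (Ideal.mem_sup_left (T := Ideal.span {esymm (Fin n) K 1 ^ d})
        (esymm_sub_mem_esymmPowIdeal (n := n) c (i + 1)))
    have h2 := Ideal.mem_sup_right
      (S := esymmPowIdeal n c ⊔ Ideal.span {esymm (Fin n) K 1 ^ d})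
      (Ideal.mul_mem_left _ (C (c (i + 1))) (Ideal.pow_mem_of_mem _
        (Ideal.mem_span_singleton_self (esymm (Fin n) K 1)) (i + 1) i.succ_pos))
    simpa using add_mem h1 h2

theorem constantCoeff_eq_zero_of_mem_coinvariantIdeal {n : ℕ} {u : MvPolynomial (Fin n) K}
    (hu : u ∈ coinvariantIdeal K n) : constantCoeff u = 0 := by
  have : coinvariantIdeal K n ≤ RingHom.ker (constantCoeff (R := K) (σ := Fin n)) := by
    refine coinvariantIdeal_le fun i => ?_
    rw [RingHom.mem_ker, constantCoeff_eq]
    exact (show (esymm (Fin n) K (i + 1)).IsHomogeneous (i + 1) from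
      esymm_mem_homogeneousSubmodule n (i + 1)).coeff_eq_zero (by simp)
  exact this hu

theorem esymm_one_pow_notMem {n : ℕ} {c : ℕ → K} (h0 : c 0 = 1) (h1 : c 1 = 1)
    (hc : ∀ i, n < i → c i = 0) {j d : ℕ} (hj : j < d) :
    esymm (Fin n) K 1 ^ j ∉ esymmPowIdeal n c ⊔ Ideal.span {esymm (Fin n) K 1 ^ d} := by
  intro h
  obtain ⟨y, hy, v, hv, h⟩ := Submodule.mem_sup.mp h
  obtain ⟨w, rfl⟩ := Ideal.mem_span_singleton'.mp hv
  have h2 : 1 - esymm (Fin n) K 1 ^ (d - j) * w ∈ esymmPowIdeal n c := by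
    refine mem_esymmPowIdeal_of_esymm_one_mul_mem h0 h1 hc (j := j) ?_
    convert hy using 1
    rw [mul_sub, ← mul_assoc, ← pow_add, Nat.add_sub_cancel' hj.le]
    linear_combination -h
  have h3 : esymmPowIdeal n c ≤ coinvariantIdeal K n := by
    rw [← esymmPowIdeal_sup_span n h0 (d := 1) one_pos, sup_assoc]
    exact le_sup_left
  have h4 := constantCoeff_eq_zero_of_mem_coinvariantIdeal (h3 h2)
  have h5 := constantCoeff_eq_zero_of_mem_coinvariantIdeal
    (esymm_succ_mem_coinvariantIdeal (K := K) n 0)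
  simp only [zero_add] at h5
  rw [map_sub, map_mul, map_pow, h5, zero_pow (by omega)] at h4
  simp at h4

theorem esymmPowIdeal_sup_span_isHomogeneous (n : ℕ) (c : ℕ → K) (d : ℕ) :
    (esymmPowIdeal n c ⊔ Ideal.span {esymm (Fin n) K 1 ^ d}).IsHomogeneous
      (homogeneousSubmodule (Fin n) K) := by
  have hpow : ∀ i, esymm (Fin n) K 1 ^ i ∈ homogeneousSubmodule (Fin n) K i := fun i => by
    simpa using SetLike.pow_mem_graded i (esymm_mem_homogeneousSubmodule (K := K) n 1)
  refine Ideal.IsHomogeneous.sup (Ideal.homogeneous_span _ _ ?_) (Ideal.homogeneous_span _ _ ?_)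
  · rintro _ ⟨i, rfl⟩
    refine ⟨i, sub_mem (esymm_mem_homogeneousSubmodule n i) ?_⟩
    rw [← smul_eq_C_mul]
    exact Submodule.smul_mem _ _ (hpow i)
  · rintro _ rfl
    exact ⟨d, hpow d⟩

theorem exists_isLefschetzMod_esymmPowIdeal [CharZero K] {n : ℕ} {c : ℕ → K} (h0 : c 0 = 1)
    (h1 : c 1 = 1) (hc : ∀ i, n < i → c i = 0) {d : ℕ} (hd : 0 < d) :
    ∃ k g, IsLefschetzMod (homogeneousSubmodule (Fin n) K)
      (esymmPowIdeal n c ⊔ Ideal.span {esymm (Fin n) K 1 ^ d}) k g := by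
  have := finiteDimensional_homogeneousSubmodule (K := K) n
  obtain ⟨k, g, h⟩ := exists_isLefschetzMod_coinvariantIdeal (K := K) n
  rw [← esymmPowIdeal_sup_span n h0 hd] at h
  exact ⟨_, IsLefschetzMod.exists_of_sup_span_singleton
    (esymmPowIdeal_sup_span_isHomogeneous n c d) (z := esymm (Fin n) K 1)
    (esymm_mem_homogeneousSubmodule n 1) hd
    (Ideal.mem_sup_right (Ideal.mem_span_singleton_self _))
    (fun i hi u hu => by
      obtain ⟨y, hy, v, hv, h⟩ := Submodule.mem_sup.mp hu
      obtain ⟨w, rfl⟩ := Ideal.mem_span_singleton'.mp hv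
      refine ⟨w, Ideal.mem_sup_left
        (mem_esymmPowIdeal_of_esymm_one_mul_mem h0 h1 hc (j := i) ?_)⟩
      convert hy using 1
      rw [mul_sub, ← mul_assoc, ← pow_add, Nat.add_sub_cancel' hi]
      linear_combination -h) h⟩

end PowerIdeal

end Esymm

section SymmetricQuotient

open MvPolynomial

variable {K : Type} [Field K] {n : ℕ}

variable (K n) in
/-- The symmetric polynomials that are homogeneous of degree `D`. -/
noncomputable def symHomogeneous (D : ℕ) : Submodule K ↥(symS K n) :=
  Submodule.comap (symS K n).val.toLinearMap (homogeneousSubmodule (Fin n) K D)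

theorem mem_symHomogeneous {D : ℕ} {s : ↥(symS K n)} :
    s ∈ symHomogeneous K n D ↔ (s : MvPolynomial (Fin n) K).IsHomogeneous D :=
  Iff.rfl

theorem pow_mem_symHomogeneous {D : ℕ} {s : ↥(symS K n)} (hs : s ∈ symHomogeneous K n D)
    (m : ℕ) : s ^ m ∈ symHomogeneous K n (D * m) :=
  IsHomogeneous.pow (mem_symHomogeneous.mp hs) m

theorem esymmS_mem_symHomogeneous (k : ℕ) : esymmS K n k ∈ symHomogeneous K n k :=
  esymm_mem_homogeneousSubmodule n k

theorem esymmS_of_lt {k : ℕ} (h : n < k) : esymmS K n k = 0 :=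
  Subtype.ext (esymm_of_lt h)

theorem prod_esymmS_mem_symHomogeneous (m : Fin n →₀ ℕ) :
    ∏ i : Fin n, esymmS K n (i + 1) ^ m i ∈ symHomogeneous K n (∑ i : Fin n, (i + 1) * m i) := by
  rw [mem_symHomogeneous]
  push_cast
  exact IsHomogeneous.prod _ _ _ fun i _ => pow_mem_symHomogeneous (esymmS_mem_symHomogeneous _) _

theorem mem_span_prod_esymmS {D : ℕ} {s : ↥(symS K n)} (hs : s ∈ symHomogeneous K n D) :
    s ∈ Submodule.span K {t | ∃ m : Fin n →₀ ℕ, ∑ i : Fin n, (i + 1) * m i = D ∧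
      t = ∏ i : Fin n, esymmS K n (i + 1) ^ m i} := by
  obtain ⟨p, hp⟩ := esymmAlgHom_fin_surjective K (le_refl n)
    (⟨s, s.2⟩ : symmetricSubalgebra (Fin n) K)
  have hval : (s : MvPolynomial (Fin n) K) = ∑ m ∈ p.support, p.coeff m •
      ((∏ i : Fin n, esymmS K n (i + 1) ^ m i : ↥(symS K n)) : MvPolynomial (Fin n) K) := by
    have h1 := congrArg Subtype.val hp
    rw [← h1, esymmAlgHom_apply, aeval_def, eval₂_eq']
    refine Finset.sum_congr rfl fun m _ => ?_
    rw [Algebra.smul_def]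
    push_cast
    rfl
  have hs' : s = ∑ m ∈ p.support with ∑ i : Fin n, ((i : ℕ) + 1) * m i = D, p.coeff m •
      ∏ i : Fin n, esymmS K n (i + 1) ^ m i := by
    apply Subtype.ext
    have h1 : homogeneousComponent D (s : MvPolynomial (Fin n) K) = s := by
      rw [homogeneousComponent_of_mem (mem_symHomogeneous.mp hs), if_pos rfl]
    rw [← h1, hval, map_sum, Finset.sum_filter]
    push_cast
    refine Finset.sum_congr rfl fun m _ => ?_
    have h2 := prod_esymmS_mem_symHomogeneous (K := K) m
    rw [mem_symHomogeneous] at h2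
    push_cast at h2
    rw [map_smul, homogeneousComponent_of_mem h2]
    split_ifs with h3 h4 h4
    · simp
    · exact absurd h3.symm h4
    · exact absurd h4.symm h3
    · simp
  rw [hs']
  refine sum_mem fun m hm => Submodule.smul_mem _ _ (Submodule.subset_span ⟨m, ?_, rfl⟩)
  exact (Finset.mem_filter.mp hm).2

theorem exists_sub_smul_esymmS_mem_span {D : ℕ} (hD : 0 < D) {s : ↥(symS K n)}
    (hs : s ∈ symHomogeneous K n D) :
    ∃ a : K, s - a • esymmS K n D ∈ Submodule.span K {t | ∃ l, 0 < l ∧ l < D ∧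
      ∃ u ∈ symHomogeneous K n (D - l), t = esymmS K n l * u} := by
  refine Submodule.span_induction ?_ ⟨0, by simp⟩ ?_ ?_ (mem_span_prod_esymmS hs)
  · rintro _ ⟨m, hm, rfl⟩
    obtain ⟨i, hi⟩ : ∃ i, m i ≠ 0 := by
      by_contra! h
      simp [h] at hm
      omega
    have hle : Finsupp.single i 1 ≤ m := by
      rwa [Finsupp.single_le_iff, Nat.one_le_iff_ne_zero]
    obtain ⟨m', rfl⟩ := exists_add_of_le hle
    have hw : (i : ℕ) + 1 + ∑ j : Fin n, ((j : ℕ) + 1) * m' j = D := by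
      rw [← hm]
      simp [mul_add, Finset.sum_add_distrib, Finsupp.single_apply]
    have hprod : ∏ j : Fin n, esymmS K n (j + 1) ^ (Finsupp.single i 1 + m' : Fin n →₀ ℕ) j =
        esymmS K n (i + 1) * ∏ j : Fin n, esymmS K n (j + 1) ^ m' j := by
      simp only [Finsupp.add_apply, pow_add, Finset.prod_mul_distrib]
      rw [Finset.prod_eq_single i (fun j _ hj => by simp [Finsupp.single_eq_of_ne hj]) (by simp)]
      simp
    rw [hprod]
    rcases Nat.eq_zero_or_pos (∑ j : Fin n, ((j : ℕ) + 1) * m' j) with h0 | h0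
    · have hm' : ∀ j, m' j = 0 := fun j => by
        have := Finset.sum_eq_zero_iff.mp h0 j (Finset.mem_univ j)
        simpa using this
      refine ⟨1, ?_⟩
      rw [← hw, h0]
      simp [hm']
    · refine ⟨0, ?_⟩
      rw [zero_smul, sub_zero]
      refine Submodule.subset_span ⟨i + 1, by omega, by omega, _, ?_, rfl⟩
      have := prod_esymmS_mem_symHomogeneous (K := K) m'
      rwa [show ∑ j : Fin n, ((j : ℕ) + 1) * m' j = D - (i + 1) by omega] at this
  · rintro s t - - ⟨a, ha⟩ ⟨b, hb⟩
    refine ⟨a + b, ?_⟩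
    convert add_mem ha hb using 1
    rw [add_smul]
    abel
  · rintro r s - ⟨a, ha⟩
    refine ⟨r * a, ?_⟩
    convert Submodule.smul_mem _ r ha using 1
    rw [smul_sub, mul_smul]

/-- `s` is congruent modulo `𝔯` to a scalar multiple of the power of `e_k` of degree `D`, the
scalar being zero if there is no such power. -/
def IsPowMod (𝔯 : Ideal ↥(symS K n)) (k D : ℕ) (s : ↥(symS K n)) : Prop :=
  ∃ κ : K, (κ ≠ 0 → k ∣ D) ∧ s - κ • esymmS K n k ^ (D / k) ∈ 𝔯

theorem smul_mem_of_mem {𝔯 : Ideal ↥(symS K n)} (r : K) {s : ↥(symS K n)} (hs : s ∈ 𝔯) :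
    r • s ∈ 𝔯 := by
  rw [Algebra.smul_def]
  exact 𝔯.mul_mem_left _ hs

namespace IsPowMod

variable {𝔯 𝔰 : Ideal ↥(symS K n)} {k D D' : ℕ} {s t : ↥(symS K n)}

theorem of_mem (hs : s ∈ 𝔯) : IsPowMod 𝔯 k D s := ⟨0, by simp, by simpa using hs⟩

theorem mono (h : IsPowMod 𝔯 k D s) (hle : 𝔯 ≤ 𝔰) : IsPowMod 𝔰 k D s :=
  let ⟨κ, h1, h2⟩ := h
  ⟨κ, h1, hle h2⟩

theorem add (hs : IsPowMod 𝔯 k D s) (ht : IsPowMod 𝔯 k D t) : IsPowMod 𝔯 k D (s + t) := by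
  obtain ⟨κ, h1, h2⟩ := hs
  obtain ⟨κ', h1', h2'⟩ := ht
  refine ⟨κ + κ', fun h => ?_, ?_⟩
  · by_cases h0 : κ = 0
    · exact h1' (by simpa [h0] using h)
    · exact h1 h0
  · convert add_mem h2 h2' using 1
    rw [add_smul]
    abel

theorem smul (r : K) (hs : IsPowMod 𝔯 k D s) : IsPowMod 𝔯 k D (r • s) := by
  obtain ⟨κ, h1, h2⟩ := hs
  refine ⟨r * κ, fun h => h1 (right_ne_zero_of_mul h), ?_⟩
  rw [mul_smul, ← smul_sub]
  exact smul_mem_of_mem r h2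

theorem mul (hs : IsPowMod 𝔯 k D s) (ht : IsPowMod 𝔯 k D' t) :
    IsPowMod 𝔯 k (D + D') (s * t) := by
  obtain ⟨κ, h1, h2⟩ := hs
  obtain ⟨κ', h1', h2'⟩ := ht
  by_cases h0 : κ = 0
  · refine of_mem (𝔯.mul_mem_right _ ?_)
    simpa [h0] using h2
  by_cases h0' : κ' = 0
  · refine of_mem (𝔯.mul_mem_left _ ?_)
    simpa [h0'] using h2'
  refine ⟨κ * κ', fun _ => dvd_add (h1 h0) (h1' h0'), ?_⟩
  rw [Nat.add_div_of_dvd_right (h1 h0), pow_add, ← smul_mul_smul_comm]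
  convert add_mem (𝔯.mul_mem_right t h2)
    (𝔯.mul_mem_left (κ • esymmS K n k ^ (D / k)) h2') using 1
  ring

theorem of_mem_span {A : Set ↥(symS K n)} (hA : ∀ t ∈ A, IsPowMod 𝔯 k D t)
    (hs : s ∈ Submodule.span K A) : IsPowMod 𝔯 k D s :=
  Submodule.span_induction hA (of_mem (zero_mem _)) (fun _ _ _ _ h h' => h.add h')
    (fun r _ _ h => h.smul r) hs

theorem of_mem_symHomogeneous_aux {L : ℕ} (hL : ∀ l, 0 < l → l ≤ L → IsPowMod 𝔯 k l (esymmS K n l))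
    (D : ℕ) (hD : D ≤ L) : ∀ s ∈ symHomogeneous K n D, IsPowMod 𝔯 k D s := by
  induction D using Nat.strong_induction_on with
  | _ D ih =>
    intro s hs
    rcases Nat.eq_zero_or_pos D with rfl | hD0
    · refine ⟨coeff 0 (s : MvPolynomial (Fin n) K), fun _ => dvd_zero k, ?_⟩
      have h1 := (totalDegree_eq_zero_iff_eq_C).mp
        (Nat.le_zero.mp (mem_symHomogeneous.mp hs).totalDegree_le)
      convert zero_mem 𝔯
      rw [Nat.zero_div, pow_zero, sub_eq_zero]
      refine Subtype.ext (h1.trans ?_)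
      rw [← mul_one (C _), ← smul_eq_C_mul]
      rfl
    · obtain ⟨a, ha⟩ := exists_sub_smul_esymmS_mem_span hD0 hs
      rw [← sub_add_cancel s (a • esymmS K n D)]
      refine (of_mem_span ?_ ha).add ((hL D hD0 hD).smul a)
      rintro _ ⟨l, hl, hlD, u, hu, rfl⟩
      have := (hL l hl (by omega)).mul (ih (D - l) (by omega) (by omega) u hu)
      rwa [Nat.add_sub_cancel' hlD.le] at this

theorem exists_sub_smul_esymmS {L : ℕ}
    (hL : ∀ l, 0 < l → l ≤ L → IsPowMod 𝔯 k l (esymmS K n l))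
    (hs : s ∈ symHomogeneous K n (L + 1)) :
    ∃ a : K, IsPowMod 𝔯 k (L + 1) (s - a • esymmS K n (L + 1)) := by
  obtain ⟨a, ha⟩ := exists_sub_smul_esymmS_mem_span L.succ_pos hs
  refine ⟨a, of_mem_span ?_ ha⟩
  rintro _ ⟨l, hl, hlD, u, hu, rfl⟩
  have := (hL l hl (by omega)).mul (of_mem_symHomogeneous_aux hL (L + 1 - l) (by omega) u hu)
  rwa [Nat.add_sub_cancel' hlD.le] at this

theorem of_mem_symHomogeneous (hL : ∀ l, 0 < l → l ≤ n → IsPowMod 𝔯 k l (esymmS K n l))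
    (hs : s ∈ symHomogeneous K n D) : IsPowMod 𝔯 k D s := by
  refine of_mem_symHomogeneous_aux (L := D) (fun l hl _ => ?_) D le_rfl s hs
  rcases le_or_gt l n with h | h
  · exact hL l hl h
  · exact of_mem (by rw [esymmS_of_lt h]; exact zero_mem _)

end IsPowMod

/-- Modulo `𝔯`, the elementary symmetric polynomials of degree at most `j` are scalar multiples
of powers of `e_k`. -/
def EsymmPowMod (𝔯 : Ideal ↥(symS K n)) (k j : ℕ) : Prop :=
  ∀ l, 0 < l → l ≤ j → IsPowMod 𝔯 k l (esymmS K n l)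

namespace EsymmPowMod

variable {𝔯 𝔰 : Ideal ↥(symS K n)} {k j : ℕ}

theorem mono (h : EsymmPowMod 𝔯 k j) (hle : 𝔯 ≤ 𝔰) : EsymmPowMod 𝔰 k j :=
  fun l hl hlj => (h l hl hlj).mono hle

theorem sup_span_singleton (h : EsymmPowMod 𝔯 k j) {f : ↥(symS K n)}
    (hf : f ∈ symHomogeneous K n (j + 1)) (hf0 : f ∉ 𝔯) :
    EsymmPowMod (𝔯 ⊔ Ideal.span {f}) k (j + 1) ∨
      EsymmPowMod (𝔯 ⊔ Ideal.span {f}).radical (j + 1) (j + 1) := by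
  obtain ⟨a, ha⟩ := IsPowMod.exists_sub_smul_esymmS h hf
  have hfmem : f ∈ 𝔯 ⊔ Ideal.span {f} := Ideal.mem_sup_right (Ideal.mem_span_singleton_self f)
  by_cases ha0 : a = 0
  · right
    rw [ha0, zero_smul, sub_zero] at ha
    obtain ⟨κ, hκ, hmem⟩ := ha
    have hκ0 : κ ≠ 0 := by
      rintro rfl
      exact hf0 (by simpa using hmem)
    have hpow : ∀ l, 0 < l → k ∣ l → l / k ≠ 0 := fun l hl hkl =>
      (Nat.div_pos (Nat.le_of_dvd hl hkl) (Nat.pos_of_dvd_of_pos hkl hl)).ne'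
    have hk : esymmS K n k ∈ (𝔯 ⊔ Ideal.span {f}).radical := by
      refine ⟨(j + 1) / k, ?_⟩
      have h1 := smul_mem_of_mem κ⁻¹ (sub_mem hfmem (Ideal.mem_sup_left hmem))
      rwa [sub_sub_cancel, inv_smul_smul₀ hκ0] at h1
    intro l hl hlj
    rcases Nat.lt_or_ge j l with hlj' | hlj'
    · obtain rfl : l = j + 1 := by omega
      exact ⟨1, by simp, by simp [Nat.div_self hl]⟩
    · obtain ⟨b, hb, hbmem⟩ := h l hl hlj'
      refine IsPowMod.of_mem ?_
      rw [← sub_add_cancel (esymmS K n l) (b • esymmS K n k ^ (l / k))]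
      refine add_mem (Ideal.le_radical (Ideal.mem_sup_left hbmem)) ?_
      by_cases hb0 : b = 0
      · simp [hb0]
      · exact smul_mem_of_mem b (Ideal.pow_mem_of_mem _ hk _
          (Nat.pos_of_ne_zero (hpow l hl (hb hb0))))
  · left
    intro l hl hlj
    rcases Nat.lt_or_ge j l with hlj' | hlj'
    · obtain rfl : l = j + 1 := by omega
      have h1 := ((IsPowMod.of_mem hfmem).add
        ((ha.mono le_sup_left).smul (-1))).smul a⁻¹
      convert h1 using 1
      rw [neg_one_smul, ← sub_eq_add_neg, sub_sub_cancel, inv_smul_smul₀ ha0]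
    · exact (h l hl hlj').mono le_sup_left

end EsymmPowMod

theorem esymmPowMod_one (𝔯 : Ideal ↥(symS K n)) : EsymmPowMod 𝔯 1 1 := by
  intro l hl hl1
  obtain rfl : l = 1 := by omega
  exact ⟨1, by simp, by simp⟩

theorem esymmPowMod_span_image_Iio {N : ℕ} {f : ℕ → ↥(symS K n)}
    (hf : ∀ i < N, f i ∈ symHomogeneous K n (i + 2))
    (hreg : ∀ i < N, f i ∉ (Ideal.span (f '' Set.Iio i)).radical) :
    ∀ i ≤ N, EsymmPowMod (Ideal.span (f '' Set.Iio i)) 1 (i + 1) ∨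
      ∃ k, 2 ≤ k ∧ k ≤ i + 1 ∧ EsymmPowMod (Ideal.span (f '' Set.Iio i)).radical k (i + 1) := by
  intro i
  induction i with
  | zero => exact fun _ => .inl (esymmPowMod_one _)
  | succ i ih =>
    intro hi
    have hsucc : Ideal.span (f '' Set.Iio (i + 1)) =
        Ideal.span (f '' Set.Iio i) ⊔ Ideal.span {f i} := by
      rw [← Ideal.span_union, ← Set.image_singleton, ← Set.image_union]
      congr 2
      ext j
      simp
    rw [hsucc]
    rcases ih (by omega) with h | ⟨k, hk2, hki, h⟩
    · rcases h.sup_span_singleton (hf i hi)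
        (fun hmem => hreg i hi (Ideal.le_radical hmem)) with h' | h'
      · exact .inl h'
      · exact .inr ⟨i + 2, by omega, le_rfl, h'⟩
    · have hle : (Ideal.span (f '' Set.Iio i)).radical ⊔ Ideal.span {f i} ≤
          (Ideal.span (f '' Set.Iio i) ⊔ Ideal.span {f i}).radical :=
        sup_le (Ideal.radical_mono le_sup_left) (le_sup_right.trans Ideal.le_radical)
      rcases h.sup_span_singleton (hf i hi) (hreg i hi) with h' | h'
      · exact .inr ⟨k, hk2, by omega, h'.mono hle⟩
      · refine .inr ⟨i + 2, by omega, le_rfl, h'.mono ?_⟩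
        rw [← Ideal.radical_idem (Ideal.span (f '' Set.Iio i) ⊔ Ideal.span {f i})]
        exact Ideal.radical_mono hle

variable (n) in
/-- The ideal of the ring of symmetric polynomials generated by all `e_i - c_i e_1^i`. -/
noncomputable def esymmPowIdealS (c : ℕ → K) : Ideal ↥(symS K n) :=
  Ideal.span (Set.range fun i => esymmS K n i - c i • esymmS K n 1 ^ i)

theorem exists_sub_smul_mem_esymmPowIdealS (c : ℕ → K) {D : ℕ} {s : ↥(symS K n)}
    (hs : s ∈ symHomogeneous K n D) :
    ∃ κ : K, s - κ • esymmS K n 1 ^ D ∈ esymmPowIdealS n c := by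
  obtain ⟨κ, -, h⟩ := IsPowMod.of_mem_symHomogeneous (𝔯 := esymmPowIdealS n c) (k := 1)
    (fun l _ _ => ⟨c l, by simp, by
      rw [Nat.div_one]
      exact Ideal.subset_span ⟨l, rfl⟩⟩) hs
  exact ⟨κ, by rwa [Nat.div_one] at h⟩

theorem exists_esymmPowIdealS_eq_span (hn : 0 < n) {d : ℕ} (hdn : n < d) (hd : d.Prime)
    {f : ℕ → ↥(symS K n)} (hf : ∀ i < n - 1, f i ∈ symHomogeneous K n (i + 2))
    (hfd : f (n - 1) ∈ symHomogeneous K n d)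
    (hreg : ∀ i ≤ n - 1, f i ∉ (Ideal.span (f '' Set.Iio i)).radical) :
    ∃ c : ℕ → K, c 0 = 1 ∧ c 1 = 1 ∧ (∀ i, n < i → c i = 0) ∧
      Ideal.span (f '' Set.Iio (n - 1)) = esymmPowIdealS n c ∧
      esymmPowIdealS n c ⊔ Ideal.span {f (n - 1)} =
        esymmPowIdealS n c ⊔ Ideal.span {esymmS K n 1 ^ d} := by
  set P := Ideal.span (f '' Set.Iio (n - 1))
  have hgood : EsymmPowMod P 1 n := by
    have h := esymmPowMod_span_image_Iio hf (fun i hi => hreg i hi.le) (n - 1) le_rfl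
    rw [Nat.sub_add_cancel hn] at h
    rcases h with h | ⟨k, hk2, hkn, h⟩
    · exact h
    · obtain ⟨κ, hκ, hmem⟩ := IsPowMod.of_mem_symHomogeneous h hfd
      have hκ0 : κ = 0 := by
        by_contra hκ0
        rcases (Nat.dvd_prime hd).mp (hκ hκ0) with h1 | h1 <;> omega
      rw [hκ0, zero_smul, sub_zero] at hmem
      exact absurd hmem (hreg _ le_rfl)
  have hex : ∀ l, ∃ b : K, 0 < l → l ≤ n → esymmS K n l - b • esymmS K n 1 ^ l ∈ P := by
    intro l
    by_cases hl : 0 < l ∧ l ≤ n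
    · obtain ⟨κ, -, h⟩ := hgood l hl.1 hl.2
      exact ⟨κ, fun _ _ => by rwa [Nat.div_one] at h⟩
    · exact ⟨0, fun h1 h2 => absurd ⟨h1, h2⟩ hl⟩
  choose b hb using hex
  set c : ℕ → K := fun l => if l ≤ 1 then 1 else if l ≤ n then b l else 0 with hc
  have hcn : ∀ i, n < i → c i = 0 := fun i hi => by
    simp only [hc]
    rw [if_neg (by omega), if_neg (by omega)]
  have hle : esymmPowIdealS n c ≤ P := by
    refine Ideal.span_le.mpr ?_
    rintro _ ⟨l, rfl⟩
    rcases Nat.lt_or_ge 1 l with h1 | h1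
    · rcases Nat.lt_or_ge n l with h2 | h2
      · simp [hcn l h2, esymmS_of_lt h2]
      · simpa [hc, h2, not_le.mpr h1] using hb l (by omega) h2
    · have : esymmS K n l - c l • esymmS K n 1 ^ l = 0 := by
        interval_cases l
        · simp only [hc, zero_le, if_true, one_smul, pow_zero, sub_eq_zero]
          exact Subtype.ext (esymm_zero (Fin n) K)
        · simp [hc]
      simp only [this]
      exact zero_mem P
  obtain ⟨κ, hκ⟩ := exists_sub_smul_mem_esymmPowIdealS c hfd
  have hfdnot := hreg _ le_rfl
  have hE1 : esymmS K n 1 ∉ P.radical := by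
    intro h
    refine hfdnot ?_
    rw [← sub_add_cancel (f (n - 1)) (κ • esymmS K n 1 ^ d)]
    exact add_mem (Ideal.le_radical (hle hκ))
      (smul_mem_of_mem _ (Ideal.pow_mem_of_mem _ h _ hd.pos))
  have hκ0 : κ ≠ 0 := by
    rintro rfl
    rw [zero_smul, sub_zero] at hκ
    exact hfdnot (Ideal.le_radical (hle hκ))
  have heq : P = esymmPowIdealS n c := by
    refine le_antisymm (Ideal.span_le.mpr ?_) hle
    rintro _ ⟨i, hi, rfl⟩
    obtain ⟨r, hr⟩ := exists_sub_smul_mem_esymmPowIdealS c (hf i hi)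
    by_cases hr0 : r = 0
    · simpa [hr0] using hr
    · refine absurd ⟨i + 2, ?_⟩ hE1
      have h1 := smul_mem_of_mem r⁻¹ (sub_mem (Ideal.subset_span (Set.mem_image_of_mem f hi)) (hle hr))
      rwa [sub_sub_cancel, inv_smul_smul₀ hr0] at h1
  refine ⟨c, by simp [hc], by simp [hc], hcn, heq, ?_⟩
  have hfmem : f (n - 1) ∈ esymmPowIdealS n c ⊔ Ideal.span {f (n - 1)} :=
    Ideal.mem_sup_right (Ideal.mem_span_singleton_self _)
  have hEmem : esymmS K n 1 ^ d ∈ esymmPowIdealS n c ⊔ Ideal.span {esymmS K n 1 ^ d} :=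
    Ideal.mem_sup_right (Ideal.mem_span_singleton_self _)
  refine le_antisymm (sup_le le_sup_left ?_) (sup_le le_sup_left ?_)
  · rw [Ideal.span_singleton_le_iff_mem, ← sub_add_cancel (f (n - 1)) (κ • esymmS K n 1 ^ d)]
    exact add_mem (Ideal.mem_sup_left hκ) (smul_mem_of_mem _ hEmem)
  · rw [Ideal.span_singleton_le_iff_mem]
    have h1 := smul_mem_of_mem κ⁻¹ (sub_mem hfmem (Ideal.mem_sup_left hκ))
    rwa [sub_sub_cancel, inv_smul_smul₀ hκ0] at h1

end SymmetricQuotient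

theorem RingTheory.Sequence.IsRegular.getElem_notMem_radical {S : Type*} [CommRing S]
    {rs : List S} (h : RingTheory.Sequence.IsRegular S rs) {i : ℕ} (hi : i < rs.length) :
    rs[i] ∉ (Ideal.ofList (rs.take i)).radical := by
  rintro ⟨m, hm⟩
  have h1 := (h.regular_mod_prev i hi).pow m
  refine h.top_ne_smul ?_
  have h2 : (1 : S) ∈ Ideal.ofList (rs.take i) := by
    have h3 : (Submodule.Quotient.mk 1 :
        S ⧸ (Ideal.ofList (rs.take i) • ⊤ : Submodule S S)) = 0 := by
      refine h1 ?_
      simp only [smul_zero]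
      rw [← Submodule.Quotient.mk_smul, Submodule.Quotient.mk_eq_zero]
      simpa using hm
    rw [Submodule.Quotient.mk_eq_zero] at h3
    simpa using h3
  have h4 : Ideal.ofList (rs.take i) ≤ Ideal.ofList rs :=
    Ideal.span_mono fun x hx => List.mem_of_mem_take hx
  rw [(Ideal.eq_top_iff_one _).mpr (h4 h2)]
  simp

section HasSLP

open MvPolynomial

variable {K : Type} [Field K] {n : ℕ}

theorem IsLefschetzMod.algHasSLP {I : Ideal (MvPolynomial (Fin n) K)} {c : ℕ}
    {g : MvPolynomial (Fin n) K} (h : IsLefschetzMod (homogeneousSubmodule (Fin n) K) I c g)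
    (hI : 1 ∉ I) : AlgHasSLP K (quotGrading K n I) := by
  have hmk : ∀ i, ∀ v ∈ homogeneousSubmodule (Fin n) K i,
      Ideal.Quotient.mk I v ∈ quotGrading K n I i := fun i v hv => ⟨v, hv, rfl⟩
  refine ⟨c, ⟨fun hbot => hI ?_, fun i hi => (Submodule.eq_bot_iff _).mpr ?_⟩,
    Ideal.Quotient.mk I g, hmk 1 g h.mem, fun i hi => ⟨?_, ?_⟩⟩
  · have h1 := hmk c (g ^ c) (by simpa using h.mem.pow c)
    rw [hbot, Submodule.mem_bot, Ideal.Quotient.eq_zero_iff_mem] at h1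
    exact h.inj 0 (by omega) 1 (isHomogeneous_one _ _) (by simpa using h1)
  · rintro _ ⟨v, hv, rfl⟩
    exact Ideal.Quotient.eq_zero_iff_mem.mpr (h.top i hi v hv)
  · rintro _ ⟨v, hv, rfl⟩ h0
    refine Ideal.Quotient.eq_zero_iff_mem.mpr (h.inj i hi v hv ?_)
    rw [← Ideal.Quotient.eq_zero_iff_mem, map_mul, map_pow]
    exact h0
  · rintro _ ⟨w, hw, rfl⟩
    obtain ⟨v, hv, hvw⟩ := h.surj i hi w hw
    refine ⟨_, hmk i v hv, ?_⟩
    rw [← map_pow, ← map_mul]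
    exact (Ideal.Quotient.eq.mpr hvw).symm

theorem algHasSLP_symQuotGrading {J : Ideal ↥(symS K n)} {d : ℕ} (hd : 0 < d)
    (hpow : ∀ j, ∀ s ∈ symHomogeneous K n j, ∃ κ : K, s - κ • esymmS K n 1 ^ j ∈ J)
    (hmem : esymmS K n 1 ^ d ∈ J) (hnot : ∀ j < d, esymmS K n 1 ^ j ∉ J) :
    AlgHasSLP K (A := ↥(symS K n) ⧸ J) (symQuotGrading K n J) := by
  have hE : ∀ j, esymmS K n 1 ^ j ∈ symHomogeneous K n j := fun j => by
    simpa using pow_mem_symHomogeneous (esymmS_mem_symHomogeneous (K := K) (n := n) 1) j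
  have hmk : ∀ i, ∀ v ∈ symHomogeneous K n i,
      Ideal.Quotient.mk J v ∈ symQuotGrading K n J i := fun i v hv => ⟨v, hv, rfl⟩
  have hsplit : ∀ {i : ℕ} {x : ↥(symS K n) ⧸ J}, x ∈ symQuotGrading K n J i →
      ∃ κ : K, x = Ideal.Quotient.mk J (κ • esymmS K n 1 ^ i) := by
    rintro i _ ⟨v, hv, rfl⟩
    obtain ⟨κ, hκ⟩ := hpow i v hv
    exact ⟨κ, Ideal.Quotient.eq.mpr hκ⟩
  refine ⟨d - 1, ⟨fun hbot => ?_, fun i hi => (Submodule.eq_bot_iff _).mpr fun x hx => ?_⟩,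
    Ideal.Quotient.mk J (esymmS K n 1), hmk 1 _ (esymmS_mem_symHomogeneous 1),
    fun i hi => ⟨fun x hx h0 => ?_, fun x hx => ?_⟩⟩
  · have h1 := hmk _ _ (hE (d - 1))
    rw [hbot, Submodule.mem_bot, Ideal.Quotient.eq_zero_iff_mem] at h1
    exact hnot (d - 1) (by omega) h1
  · obtain ⟨κ, rfl⟩ := hsplit hx
    exact Ideal.Quotient.eq_zero_iff_mem.mpr
      (smul_mem_of_mem κ (J.pow_mem_of_pow_mem hmem (by omega)))
  · obtain ⟨κ, rfl⟩ := hsplit hx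
    rw [← map_pow, ← map_mul, Ideal.Quotient.eq_zero_iff_mem, mul_smul_comm, ← pow_add] at h0
    by_cases hκ : κ = 0
    · simp [hκ]
    · refine absurd ?_ (hnot (d - 1 - 2 * i + i) (by omega))
      simpa [inv_smul_smul₀ hκ] using smul_mem_of_mem κ⁻¹ h0
  · obtain ⟨κ, rfl⟩ := hsplit hx
    refine ⟨_, hmk i _ (Submodule.smul_mem _ κ (hE i)), ?_⟩
    rw [← map_pow, ← map_mul, mul_smul_comm, ← pow_add]
    congr 3
    omega

theorem map_esymmPowIdealS (c : ℕ → K) :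
    (esymmPowIdealS n c).map (symS K n).val = esymmPowIdeal n c := by
  rw [esymmPowIdealS, Ideal.map_span, esymmPowIdeal, ← Set.range_comp]
  congr 2
  ext1 i
  simp [esymmS, smul_eq_C_mul]

end HasSLP

/-- Proposition 8.3. Let `K` be a field of characteristic
zero and `f₂, f₃, …, f_n, f_d` symmetric homogeneous polynomials in
`R = K[x₁, …, x_n]` of degrees `2, 3, …, n, d`, forming a regular sequence in
the ring `S` of symmetric polynomials, where `d > n` and `d` is prime.  Then
both `B = S/(f₂, …, f_n, f_d)S` and `A = R/(f₂, …, f_n, f_d)R` have the SLP. -/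
theorem statement_18 (K : Type) [Field K] [CharZero K] (n : ℕ) (hn : 0 < n)
    (g : Fin (n - 1) → MvPolynomial (Fin n) K)
    (hgsym : ∀ j, (g j).IsSymmetric)
    (hghom : ∀ j : Fin (n - 1),
      g j ∈ MvPolynomial.homogeneousSubmodule (Fin n) K ((j : ℕ) + 2))
    (d : ℕ) (hdn : n < d) (hdprime : d.Prime)
    (fd : MvPolynomial (Fin n) K) (hfdsym : fd.IsSymmetric)
    (hfdhom : fd ∈ MvPolynomial.homogeneousSubmodule (Fin n) K d)
    (hreg : RingTheory.Sequence.IsRegular (↥(symS K n))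
      (((List.finRange (n - 1)).map fun j =>
          (⟨g j, (mem_symS K n _).mpr (hgsym j)⟩ : ↥(symS K n))) ++
        [⟨fd, (mem_symS K n _).mpr hfdsym⟩]))
    (J : Ideal ↥(symS K n))
    (hJ : J = Ideal.span
      ((Set.range fun j : Fin (n - 1) =>
          (⟨g j, (mem_symS K n _).mpr (hgsym j)⟩ : ↥(symS K n))) ∪
        {⟨fd, (mem_symS K n _).mpr hfdsym⟩}))
    (I : Ideal (MvPolynomial (Fin n) K))
    (hI : I = Ideal.span (Set.range g ∪ {fd})) :
    AlgHasSLP K (A := ↥(symS K n) ⧸ J) (symQuotGrading K n J) ∧ AlgHasSLP K (quotGrading K n I) := by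
  set f : ℕ → ↥(symS K n) := fun i =>
    if h : i < n - 1 then ⟨g ⟨i, h⟩, (mem_symS K n _).mpr (hgsym _)⟩
    else ⟨fd, (mem_symS K n _).mpr hfdsym⟩ with hf
  have hflt : ∀ j : Fin (n - 1), f j = ⟨g j, (mem_symS K n _).mpr (hgsym j)⟩ := fun j => by
    simp [hf]
  have hflast : f (n - 1) = ⟨fd, (mem_symS K n _).mpr hfdsym⟩ := by simp [hf]
  set rs := ((List.finRange (n - 1)).map fun j =>
    (⟨g j, (mem_symS K n _).mpr (hgsym j)⟩ : ↥(symS K n))) ++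
      [⟨fd, (mem_symS K n _).mpr hfdsym⟩] with hrs
  have hlen : rs.length = n - 1 + 1 := by simp [hrs]
  have hget : ∀ i (hi : i < rs.length), rs[i] = f i := by
    intro i hi
    simp only [hrs, hf, List.getElem_append, List.length_map, List.length_finRange]
    split_ifs <;> simp
  have hreg' : ∀ i ≤ n - 1, f i ∉ (Ideal.span (f '' Set.Iio i)).radical := by
    intro i hi hmem
    refine hreg.getElem_notMem_radical (i := i) (by omega) ?_
    rw [hget]
    refine Ideal.radical_mono (Ideal.span_mono ?_) hmem
    rintro _ ⟨j, hj, rfl⟩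
    rw [← hget j (by rw [hlen]; exact Nat.lt_succ_of_le (hj.le.trans hi))]
    exact List.mem_take_iff_getElem.mpr ⟨j, by rw [hlen]; simp at hj; omega, rfl⟩
  obtain ⟨c, h0, h1, hc, hspan, hsup⟩ := exists_esymmPowIdealS_eq_span hn hdn hdprime
    (f := f) (fun i hi => by rw [hflt ⟨i, hi⟩]; exact hghom ⟨i, hi⟩)
    (by rw [hflast]; exact hfdhom) hreg'
  have hrange : (Set.range fun j : Fin (n - 1) =>
      (⟨g j, (mem_symS K n _).mpr (hgsym j)⟩ : ↥(symS K n))) = f '' Set.Iio (n - 1) := by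
    ext x
    constructor
    · rintro ⟨j, rfl⟩
      exact ⟨j, j.2, hflt j⟩
    · rintro ⟨i, hi, rfl⟩
      exact ⟨⟨i, hi⟩, (hflt ⟨i, hi⟩).symm⟩
  have hJ' : J = esymmPowIdealS n c ⊔ Ideal.span {esymmS K n 1 ^ d} := by
    rw [hJ, Ideal.span_union, hrange, hspan, ← hflast, hsup]
  have hIJ : I = J.map (symS K n).val := by
    rw [hI, hJ, Ideal.map_span, Set.image_union, Set.image_singleton, ← Set.range_comp]
    rfl
  have hI' : I = esymmPowIdeal n c ⊔ Ideal.span {MvPolynomial.esymm (Fin n) K 1 ^ d} := by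
    rw [hIJ, hJ', Ideal.map_sup, map_esymmPowIdealS, Ideal.map_span, Set.image_singleton]
    rfl
  constructor
  · refine algHasSLP_symQuotGrading hdprime.pos (fun j s hs => ?_) ?_ fun j hj hmem => ?_
    · obtain ⟨κ, hκ⟩ := exists_sub_smul_mem_esymmPowIdealS c hs
      exact ⟨κ, hJ' ▸ Ideal.mem_sup_left hκ⟩
    · exact hJ' ▸ Ideal.mem_sup_right (Ideal.mem_span_singleton_self _)
    · refine esymm_one_pow_notMem h0 h1 hc hj ?_
      rw [← hI', hIJ]
      exact Ideal.mem_map_of_mem (symS K n).val hmem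
  · obtain ⟨k, l, hl⟩ := exists_isLefschetzMod_esymmPowIdeal h0 h1 hc hdprime.pos
    rw [hI']
    refine hl.algHasSLP fun hmem => esymm_one_pow_notMem h0 h1 hc hdprime.pos (j := 0) ?_
    rwa [pow_zero]
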